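/- arXiv:1902.08539 — 7 statements merged into one kernel-verified Lean document; each statement's English description precedes it below -/
import Mathlib

section
/- Let d and p be positive integers. There exists a function Wg : S_p → ℝ which is constant on conjugacy classes of the symmetric group S_p such that for all p-tuples i = (i_1,…,i_p), i' = (i'_1,…,i'_p), j = (j_1,…,j_p), j' = (j'_1,…,j'_p) of indices in {1,…,d}, the Haar average ∫_{U(d)} U_{i_1 j_1}⋯U_{i_p j_p} · conj(U_{i'_1 j'_1})⋯conj(U_{i'_p j'_p}) dμ(U) equals Σ_{α,β ∈ S_p} δ_{i_1, i'_{α(1)}}⋯δ_{i_p, i'_{α(p)}} · δ_{j_1, j'_{β(1)}}⋯δ_{j_p, j'_{β(p)}} · Wg(α^{-1}β). -/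
open MeasureTheory Matrix

noncomputable instance {ι : Type*} [Fintype ι] [DecidableEq ι] :
    MeasurableSpace (Matrix.unitaryGroup ι ℂ) := borel _

instance {ι : Type*} [Fintype ι] [DecidableEq ι] :
    BorelSpace (Matrix.unitaryGroup ι ℂ) := ⟨rfl⟩

namespace Wein

variable {d p : ℕ}

/-- Tensor power of a matrix. -/
def T (p : ℕ) {d : ℕ} (A : Matrix (Fin d) (Fin d) ℂ) :
    Matrix (Fin p → Fin d) (Fin p → Fin d) ℂ :=
  Matrix.of fun i j => ∏ a, A (i a) (j a)

lemma T_apply (A : Matrix (Fin d) (Fin d) ℂ) (i j : Fin p → Fin d) :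
    T p A i j = ∏ a, A (i a) (j a) := rfl

lemma T_mul (A B : Matrix (Fin d) (Fin d) ℂ) : T p (A * B) = T p A * T p B := by
  ext i j
  simp only [T_apply, Matrix.mul_apply, ← Finset.prod_mul_distrib]
  rw [Finset.prod_univ_sum, Fintype.piFinset_univ]

lemma T_one : T p (1 : Matrix (Fin d) (Fin d) ℂ) = 1 := by
  ext i j
  simp only [T_apply, Matrix.one_apply, Finset.prod_ite_zero, funext_iff]
  simp

lemma T_conjTranspose (A : Matrix (Fin d) (Fin d) ℂ) : T p Aᴴ = (T p A)ᴴ := by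
  ext i j
  simp [T_apply, Matrix.conjTranspose_apply]

/-- Permutation matrices on the tensor power. -/
def D (i i' : Fin p → Fin d) (α : Equiv.Perm (Fin p)) : ℂ :=
  ∏ a : Fin p, if i a = i' (α a) then (1 : ℂ) else 0

lemma D_eq (i i' : Fin p → Fin d) (α : Equiv.Perm (Fin p)) :
    D i i' α = if i = i' ∘ α then 1 else 0 := by
  simp only [D, Finset.prod_ite_zero, funext_iff]
  simp

lemma D_comp (i i' : Fin p → Fin d) (α σ τ : Equiv.Perm (Fin p)) :
    D (i ∘ σ) (i' ∘ τ) α = D i i' (τ * α * σ⁻¹) := by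
  simp only [D_eq]
  congr 1
  apply propext
  constructor
  · intro h
    funext a
    have := congrFun h (σ⁻¹ a)
    simpa using this
  · intro h
    funext a
    have := congrFun h (σ a)
    simpa using this

lemma D_swap (i i' : Fin p → Fin d) (α : Equiv.Perm (Fin p)) :
    D i' i α = D i i' α⁻¹ := by
  simp only [D_eq]
  congr 1
  apply propext
  constructor
  · intro h
    funext a
    have := congrFun h (α⁻¹ a)
    simpa using this.symm
  · intro h
    funext a
    have := congrFun h (α a)
    simpa using this.symm

/-- type of a pair of indices -/
noncomputable def ty (i j : Fin p → Fin d) : (Fin d × Fin d) →₀ ℕ :=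
  ∑ a, Finsupp.single (i a, j a) 1

lemma exists_perm_of_ty {i j k l : Fin p → Fin d} (h : ty i j = ty k l) :
    ∃ σ : Equiv.Perm (Fin p), i = k ∘ σ ∧ j = l ∘ σ := by
  classical
  have hc : ∀ y : Fin d × Fin d, Nonempty ({a // (i a, j a) = y} ≃ {a // (k a, l a) = y}) := by
    intro y
    rw [← Fintype.card_eq, Fintype.card_subtype, Fintype.card_subtype]
    have := DFunLike.congr_fun h y
    simpa [ty, Finsupp.finsetSum_apply, Finsupp.single_apply] using this
  have e := fun y => (hc y).some
  let σ : Equiv.Perm (Fin p) := (Equiv.sigmaFiberEquiv (fun a => (i a, j a))).symm.trans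
    ((Equiv.sigmaCongrRight e).trans (Equiv.sigmaFiberEquiv (fun a => (k a, l a))))
  have hσ : ∀ a, (k (σ a), l (σ a)) = (i a, j a) := fun a => (e (i a, j a) ⟨a, rfl⟩).2
  refine ⟨σ, ?_, ?_⟩
  · funext a; exact (congrArg Prod.fst (hσ a)).symm
  · funext a; exact (congrArg Prod.snd (hσ a)).symm

/-- count -/
lemma prod_eq_of_circle {i j : Fin p → Fin d}
    (h : ∀ z : Fin d → ℂ, (∀ k, ‖z k‖ = 1) → ∏ a, z (i a) = ∏ a, z (j a))
    (z : Fin d → ℂ) : ∏ a, z (i a) = ∏ a, z (j a) := by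
  classical
  have hcount : ∀ k, (Finset.univ.filter (fun a => i a = k)).card
      = (Finset.univ.filter (fun a => j a = k)).card := by
    intro k
    have h1 := h (fun l => if l = k then Complex.exp ((1 : ℝ) * Complex.I) else 1) (by
      intro l
      split_ifs
      · exact Complex.norm_exp_ofReal_mul_I 1
      · simp)
    rw [Finset.prod_ite, Finset.prod_ite] at h1
    simp only [Finset.prod_const, one_pow, mul_one] at h1
    rw [← Complex.exp_nat_mul, ← Complex.exp_nat_mul, Complex.exp_eq_exp_iff_exists_int] at h1
    obtain ⟨n, hn⟩ := h1
    have h2 : ((Finset.univ.filter (fun a => i a = k)).card : ℝ)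
      = (Finset.univ.filter (fun a => j a = k)).card + n * (2 * Real.pi) := by
      have := congrArg Complex.im hn
      simpa using this
    by_cases hn0 : n = 0
    · subst hn0
      simp at h2
      exact_mod_cast h2
    · exfalso
      have hirr := irrational_pi
      apply hirr
      refine ⟨(((Finset.univ.filter (fun a => i a = k)).card : ℚ)
        - (Finset.univ.filter (fun a => j a = k)).card) / (2 * n), ?_⟩
      have : (n : ℝ) ≠ 0 := by exact_mod_cast hn0
      push_cast
      rw [h2]
      field_simp
      ring
  rw [← Finset.prod_fiberwise Finset.univ i, ← Finset.prod_fiberwise Finset.univ j]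
  refine Finset.prod_congr rfl fun k _ => ?_
  rw [Finset.prod_congr rfl (g := fun _ => z k) (by intro a ha; simp at ha; rw [ha]),
    Finset.prod_congr rfl (s₁ := Finset.univ.filter (fun a => j a = k)) (g := fun _ => z k) (by intro a ha; simp at ha; rw [ha])]
  simp [hcount]

lemma T_diagonal (z : Fin d → ℂ) :
    T p (Matrix.diagonal z) = Matrix.diagonal (fun i => ∏ a, z (i a)) := by
  ext i j
  simp only [T_apply, Matrix.diagonal_apply, Finset.prod_ite_zero, funext_iff]
  simp

lemma comm_diag {M : Matrix (Fin p → Fin d) (Fin p → Fin d) ℂ}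
    (h : ∀ U ∈ Matrix.unitaryGroup (Fin d) ℂ, T p U * M = M * T p U) (z : Fin d → ℂ) :
    T p (Matrix.diagonal z) * M = M * T p (Matrix.diagonal z) := by
  rw [T_diagonal]
  ext i j
  rw [Matrix.diagonal_mul, Matrix.mul_diagonal, mul_comm]
  by_cases hM : M i j = 0
  · simp [hM]
  congr 1
  apply prod_eq_of_circle
  intro w hw
  have hU : Matrix.diagonal w ∈ Matrix.unitaryGroup (Fin d) ℂ := by
    rw [Matrix.mem_unitaryGroup_iff, Matrix.star_eq_conjTranspose, Matrix.diagonal_conjTranspose,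
      Matrix.diagonal_mul_diagonal, ← Matrix.diagonal_one]
    congr 1
    funext k
    have := Complex.mul_conj (w k)
    rw [Complex.normSq_eq_norm_sq, hw k] at this
    simpa using this
  have := h _ hU
  rw [T_diagonal] at this
  have := congrFun (congrFun this i) j
  rw [Matrix.diagonal_mul, Matrix.mul_diagonal, mul_comm] at this
  exact mul_left_cancel₀ hM this

lemma comm_herm {M : Matrix (Fin p → Fin d) (Fin p → Fin d) ℂ}
    (h : ∀ U ∈ Matrix.unitaryGroup (Fin d) ℂ, T p U * M = M * T p U)
    {A : Matrix (Fin d) (Fin d) ℂ} (hA : A.IsHermitian) :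
    T p A * M = M * T p A := by
  have hs := hA.spectral_theorem
  rw [Unitary.conjStarAlgAut_apply] at hs
  have h1 := h _ hA.eigenvectorUnitary.2
  have h2 := h _ (star hA.eigenvectorUnitary).2
  have h3 := comm_diag h (RCLike.ofReal ∘ hA.eigenvalues)
  rw [hs, T_mul, T_mul]
  have h1' : Commute _ _ := h1
  have h2' : Commute _ _ := h2
  have h3' : Commute _ _ := h3
  exact (h1'.mul_left h3').mul_left h2'

lemma comm_all {M : Matrix (Fin p → Fin d) (Fin p → Fin d) ℂ}
    (h : ∀ U ∈ Matrix.unitaryGroup (Fin d) ℂ, T p U * M = M * T p U)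
    (A : Matrix (Fin d) (Fin d) ℂ) :
    T p A * M = M * T p A := by
  obtain ⟨X, Y, hX, hY, rfl⟩ : ∃ X Y : Matrix (Fin d) (Fin d) ℂ, X.IsHermitian ∧ Y.IsHermitian ∧
      A = X + Complex.I • Y := by
    refine ⟨realPart A, imaginaryPart A, (realPart A).2, (imaginaryPart A).2,
      (realPart_add_I_smul_imaginaryPart A).symm⟩
  ext i j
  let q : Polynomial ℂ := ∑ k : Fin p → Fin d,
    ((∏ a, (Polynomial.C (X (i a) (k a)) + Polynomial.X * Polynomial.C (Y (i a) (k a))))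
      * Polynomial.C (M k j)
    - Polynomial.C (M i k) *
      ∏ a, (Polynomial.C (X (k a) (j a)) + Polynomial.X * Polynomial.C (Y (k a) (j a))))
  have hq : ∀ z : ℂ, q.eval z = (T p (X + z • Y) * M) i j - (M * T p (X + z • Y)) i j := by
    intro z
    simp [q, Polynomial.eval_finsetSum, Polynomial.eval_prod, Matrix.mul_apply, T_apply, mul_comm z]
  have hq0 : q = 0 := by
    apply Polynomial.eq_zero_of_infinite_isRoot
    apply (Set.infinite_range_of_injective Complex.ofReal_injective).mono
    rintro _ ⟨t, rfl⟩
    simp only [Set.mem_ofPred_eq, Polynomial.IsRoot]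
    rw [hq, comm_herm h, sub_self]
    apply hX.add
    rw [Matrix.IsHermitian, Matrix.conjTranspose_smul, hY.eq]
    simp
  have := hq Complex.I
  rw [hq0, Polynomial.eval_zero] at this
  exact (sub_eq_zero.mp this.symm)

lemma comm_ty {M : Matrix (Fin p → Fin d) (Fin p → Fin d) ℂ}
    (h : ∀ A, T p A * M = M * T p A) (m : (Fin d × Fin d) →₀ ℕ) (i j : Fin p → Fin d) :
    ∑ k, ((if ty i k = m then 1 else 0) * M k j - M i k * (if ty k j = m then 1 else 0)) = 0 := by
  classical
  let q : MvPolynomial (Fin d × Fin d) ℂ := ∑ k : Fin p → Fin d,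
    (MvPolynomial.C (M k j) * (∏ a, MvPolynomial.X (i a, k a))
    - MvPolynomial.C (M i k) * ∏ a, MvPolynomial.X (k a, j a))
  have hq0 : q = 0 := by
    apply MvPolynomial.funext
    intro x
    have := congrFun (congrFun (h (Matrix.of fun k l => x (k, l))) i) j
    simp only [Matrix.mul_apply, T_apply] at this
    simp [q, Finset.sum_sub_distrib, sub_eq_zero]
    simpa [mul_comm] using this
  have hX : ∀ i j : Fin p → Fin d, (∏ a, MvPolynomial.X (i a, j a) : MvPolynomial (Fin d × Fin d) ℂ)
      = MvPolynomial.monomial (ty i j) 1 := by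
    intro i j
    simp only [MvPolynomial.X, ty]
    rw [MvPolynomial.monomial_sum_one]
  have h2 := congrArg (MvPolynomial.coeff m) hq0
  simp only [q, hX, MvPolynomial.coeff_sum, MvPolynomial.coeff_sub, 
    MvPolynomial.coeff_C_mul, MvPolynomial.coeff_monomial, MvPolynomial.coeff_zero] at h2
  simpa only [mul_comm] using h2

lemma comm_inv {M : Matrix (Fin p → Fin d) (Fin p → Fin d) ℂ}
    (h : ∀ A, T p A * M = M * T p A) (B : Matrix (Fin p → Fin d) (Fin p → Fin d) ℂ)
    (hB : ∀ (σ : Equiv.Perm (Fin p)) i j, B (i ∘ σ) (j ∘ σ) = B i j) :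
    B * M = M * B := by
  classical
  have hf : ∃ b : ((Fin d × Fin d) →₀ ℕ) → ℂ, ∀ i j, B i j = b (ty i j) := by
    refine ⟨fun m => if hm : ∃ x : (Fin p → Fin d) × (Fin p → Fin d), ty x.1 x.2 = m then
      B hm.choose.1 hm.choose.2 else 0, fun i j => ?_⟩
    have hm : ∃ x : (Fin p → Fin d) × (Fin p → Fin d), ty x.1 x.2 = ty i j := ⟨(i, j), rfl⟩
    beta_reduce
    rw [dif_pos hm]
    obtain ⟨σ, h1, h2⟩ := exists_perm_of_ty hm.choose_spec
    rw [h1, h2, hB]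
  obtain ⟨b, hb⟩ := hf
  let S : Finset ((Fin d × Fin d) →₀ ℕ) :=
    Finset.univ.image (fun x : (Fin p → Fin d) × (Fin p → Fin d) => ty x.1 x.2)
  have hS : ∀ i j, B i j = ∑ m ∈ S, b m * (if ty i j = m then 1 else 0) := by
    intro i j
    have : ty i j ∈ S := Finset.mem_image.2 ⟨(i, j), Finset.mem_univ _, rfl⟩
    rw [hb]
    simp [this]
  ext i j
  rw [← sub_eq_zero, Matrix.mul_apply, Matrix.mul_apply, ← Finset.sum_sub_distrib]
  have : ∀ k, B i k * M k j - M i k * B k j = ∑ m ∈ S, b m *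
      ((if ty i k = m then 1 else 0) * M k j - M i k * (if ty k j = m then 1 else 0)) := by
    intro k
    rw [hS, hS, Finset.sum_mul, Finset.mul_sum, ← Finset.sum_sub_distrib]
    refine Finset.sum_congr rfl fun m _ => ?_
    ring
  simp only [this]
  rw [Finset.sum_comm]
  simp only [← Finset.mul_sum, comm_ty h, mul_zero, Finset.sum_const_zero]

/-- Linear combination of permutation matrices. -/
noncomputable def L (d p : ℕ) : (Equiv.Perm (Fin p) → ℂ) →ₗ[ℂ]
    Matrix (Fin p → Fin d) (Fin p → Fin d) ℂ where
  toFun c := Matrix.of fun i j => ∑ α, c α * D i j α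
  map_add' c c' := by
    ext i j
    simp [add_mul, Finset.sum_add_distrib]
  map_smul' t c := by
    ext i j
    simp [Finset.mul_sum, mul_assoc]

lemma L_apply (c : Equiv.Perm (Fin p) → ℂ) (i j : Fin p → Fin d) :
    L d p c i j = ∑ α, c α * D i j α := rfl

lemma exists_K (d p : ℕ) : ∃ K : Matrix (Fin p → Fin d) (Fin p → Fin d) ℂ →ₗ[ℂ]
    (Equiv.Perm (Fin p) → ℂ), ∀ c, L d p (K (L d p c)) = L d p c := by
  obtain ⟨s, hs⟩ := (L d p).rangeRestrict.exists_rightInverse_of_surjective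
    (LinearMap.range_rangeRestrict _)
  obtain ⟨K, hK⟩ := s.exists_extend
  refine ⟨K, fun c => ?_⟩
  have h1 : K (L d p c) = s ((L d p).rangeRestrict c) := by
    rw [← hK]; rfl
  have h2 := congrArg Subtype.val (LinearMap.congr_fun hs ((L d p).rangeRestrict c))
  rw [h1]
  exact h2

/-- Action on the first index. -/
noncomputable def sh (d : ℕ) {p : ℕ} (σ : Equiv.Perm (Fin p)) :
    Matrix (Fin p → Fin d) (Fin p → Fin d) ℂ →ₗ[ℂ] Matrix (Fin p → Fin d) (Fin p → Fin d) ℂ where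
  toFun X := Matrix.of fun i j => X (i ∘ σ) j
  map_add' _ _ := rfl
  map_smul' _ _ := rfl

lemma sh_apply (σ : Equiv.Perm (Fin p)) (X : Matrix (Fin p → Fin d) (Fin p → Fin d) ℂ)
    (i j : Fin p → Fin d) : sh d σ X i j = X (i ∘ σ) j := rfl

lemma sh_mul (σ τ : Equiv.Perm (Fin p)) (X : Matrix (Fin p → Fin d) (Fin p → Fin d) ℂ) :
    sh d σ (sh d τ X) = sh d (σ * τ) X := rfl

lemma sh_one (X : Matrix (Fin p → Fin d) (Fin p → Fin d) ℂ) : sh d 1 X = X := rfl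

lemma sh_L (σ : Equiv.Perm (Fin p)) (c : Equiv.Perm (Fin p) → ℂ) :
    sh d σ (L d p c) = L d p (fun α => c (α * σ)) := by
  ext i j
  rw [sh_apply, L_apply, L_apply]
  rw [← Equiv.sum_comp (Equiv.mulRight σ)]
  refine Finset.sum_congr rfl fun α _ => ?_
  have := D_comp i j (α * σ) σ 1
  simp at this
  simp [this]

lemma one_eq_L : (1 : Matrix (Fin p → Fin d) (Fin p → Fin d) ℂ) = L d p (Pi.single 1 1) := by
  ext i j
  rw [L_apply, Finset.sum_eq_single 1]
  · simp [D_eq, Matrix.one_apply]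
  · intro b _ hb
    simp [hb]
  · simp

/-- Equivariant projection. -/
noncomputable def Pr (K : Matrix (Fin p → Fin d) (Fin p → Fin d) ℂ →ₗ[ℂ]
    (Equiv.Perm (Fin p) → ℂ)) :
    Matrix (Fin p → Fin d) (Fin p → Fin d) ℂ →ₗ[ℂ] Matrix (Fin p → Fin d) (Fin p → Fin d) ℂ :=
  ((Fintype.card (Equiv.Perm (Fin p)) : ℂ)⁻¹) •
    ∑ σ : Equiv.Perm (Fin p), (sh d σ⁻¹) ∘ₗ (L d p) ∘ₗ K ∘ₗ (sh d σ)

lemma Pr_apply (K : Matrix (Fin p → Fin d) (Fin p → Fin d) ℂ →ₗ[ℂ]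
    (Equiv.Perm (Fin p) → ℂ)) (X) : Pr K X = ((Fintype.card (Equiv.Perm (Fin p)) : ℂ)⁻¹) •
    ∑ σ : Equiv.Perm (Fin p), sh d σ⁻¹ (L d p (K (sh d σ X))) := by
  simp [Pr]

lemma Pr_sh (K : Matrix (Fin p → Fin d) (Fin p → Fin d) ℂ →ₗ[ℂ]
    (Equiv.Perm (Fin p) → ℂ)) (τ : Equiv.Perm (Fin p)) (X) :
    Pr K (sh d τ X) = sh d τ (Pr K X) := by
  rw [Pr_apply, Pr_apply, map_smul, map_sum]
  congr 1
  rw [← Equiv.sum_comp (Equiv.mulRight τ) (fun σ => sh d τ (sh d σ⁻¹ (L d p (K (sh d σ X)))))]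
  refine Finset.sum_congr rfl fun σ _ => ?_
  rw [sh_mul, sh_mul]
  simp

lemma Pr_one {K : Matrix (Fin p → Fin d) (Fin p → Fin d) ℂ →ₗ[ℂ]
    (Equiv.Perm (Fin p) → ℂ)} (hK : ∀ c, L d p (K (L d p c)) = L d p c) :
    Pr K 1 = 1 := by
  rw [Pr_apply]
  have : ∀ σ : Equiv.Perm (Fin p), sh d σ⁻¹ (L d p (K (sh d σ 1))) = 1 := by
    intro σ
    rw [one_eq_L, sh_L σ, hK, ← sh_L σ, sh_mul, inv_mul_cancel, sh_one]
  simp only [this, Finset.sum_const, Finset.card_univ]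
  rw [← Nat.cast_smul_eq_nsmul ℂ, smul_smul, inv_mul_cancel₀, one_smul]
  exact_mod_cast Fintype.card_ne_zero

lemma Pr_mem (K : Matrix (Fin p → Fin d) (Fin p → Fin d) ℂ →ₗ[ℂ]
    (Equiv.Perm (Fin p) → ℂ)) (X) : Pr K X ∈ LinearMap.range (L d p) := by
  rw [Pr_apply]
  refine Submodule.smul_mem _ _ (Submodule.sum_mem _ fun σ _ => ?_)
  rw [sh_L]
  exact ⟨_, rfl⟩

lemma Pr_expand (K : Matrix (Fin p → Fin d) (Fin p → Fin d) ℂ →ₗ[ℂ]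
    (Equiv.Perm (Fin p) → ℂ)) (X) (i j : Fin p → Fin d) :
    Pr K X i j = ∑ k, ∑ l, X k l * Pr K (Matrix.single k l 1) i j := by
  conv_lhs => rw [Matrix.matrix_eq_sum_single X]
  simp only [map_sum, Matrix.sum_apply]
  refine Finset.sum_congr rfl fun k _ => Finset.sum_congr rfl fun l _ => ?_
  have : Matrix.single k l (X k l) = X k l • Matrix.single k l (1 : ℂ) := by
    rw [Matrix.smul_single]; simp
  rw [this, map_smul]
  rfl

lemma mem_range_of_comm {M : Matrix (Fin p → Fin d) (Fin p → Fin d) ℂ}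
    (h : ∀ U ∈ Matrix.unitaryGroup (Fin d) ℂ, T p U * M = M * T p U) :
    M ∈ LinearMap.range (L d p) := by
  obtain ⟨K, hK⟩ := exists_K d p
  suffices hM : M = Pr K M by
    rw [hM]; exact Pr_mem K M
  have hcomm : ∀ j l, (Matrix.of fun i k => Pr K (Matrix.single k l 1) i j) * M
      = M * (Matrix.of fun i k => Pr K (Matrix.single k l 1) i j) := by
    intro j l
    apply comm_inv (comm_all h)
    intro σ i k
    simp only [Matrix.of_apply]
    rw [← sh_apply σ (Pr K (Matrix.single (k ∘ σ) l 1)) i j, ← Pr_sh]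
    have hs : sh d σ (Matrix.single (k ∘ σ) l (1 : ℂ)) = Matrix.single k l 1 := ?_
    · rw [hs]
    ext a b
    rw [sh_apply]
    simp only [Matrix.single_apply]
    congr 1
    have : k ∘ σ = a ∘ σ ↔ k = a := by
      constructor
      · intro h
        funext x
        have := congrFun h (σ⁻¹ x)
        simpa using this
      · rintro rfl; rfl
    rw [this]
  ext i j
  have e1 : M i j = (M * Pr K 1) i j := by rw [Pr_one hK, mul_one]
  rw [e1, Pr_expand]
  simp only [Matrix.mul_apply]
  have e2 : ∀ m, Pr K 1 m j = ∑ k, Pr K (Matrix.single k k 1) m j := by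
    intro m
    rw [Pr_expand]
    simp [Matrix.one_apply]
  simp only [e2, Finset.mul_sum]
  rw [Finset.sum_comm]
  conv_rhs => rw [Finset.sum_comm]
  refine Finset.sum_congr rfl fun l _ => ?_
  have := congrFun (congrFun (hcomm j l) i) l
  simp only [Matrix.mul_apply, Matrix.of_apply] at this
  rw [← this]
  exact Finset.sum_congr rfl fun _ _ => mul_comm _ _

lemma exists_coeff {E : (i i' j j' : Fin p → Fin d) → ℂ}
    (h1 : ∀ j j', (Matrix.of fun i i' => E i i' j j') ∈ LinearMap.range (L d p))
    (h2 : ∀ i i', (Matrix.of fun j j' => E i i' j j') ∈ LinearMap.range (L d p)) :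
    ∃ c : Equiv.Perm (Fin p) → Equiv.Perm (Fin p) → ℂ, ∀ i i' j j',
      E i i' j j' = ∑ α, ∑ β, D i i' α * D j j' β * c α β := by
  obtain ⟨K, hK⟩ := exists_K d p
  have hK' : ∀ X ∈ LinearMap.range (L d p), L d p (K X) = X := by
    rintro _ ⟨c, rfl⟩; exact hK c
  have hexp : ∀ X ∈ LinearMap.range (L d p), ∀ i j, X i j =
      ∑ α, (∑ k, ∑ l, X k l * K (Matrix.single k l 1) α) * D i j α := by
    intro X hX i j
    conv_lhs => rw [← hK' X hX, L_apply]
    refine Finset.sum_congr rfl fun α _ => ?_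
    congr 1
    conv_lhs => rw [Matrix.matrix_eq_sum_single X]
    simp only [map_sum, Finset.sum_apply]
    refine Finset.sum_congr rfl fun k _ => Finset.sum_congr rfl fun l _ => ?_
    have : Matrix.single k l (X k l) = X k l • Matrix.single k l (1 : ℂ) := by
      rw [Matrix.smul_single]; simp
    rw [this, map_smul]
    rfl
  refine ⟨fun α β => ∑ k, ∑ l, (∑ m, ∑ n, E k l m n * K (Matrix.single m n 1) β)
    * K (Matrix.single k l 1) α, fun i i' j j' => ?_⟩
  have a1 := hexp _ (h1 j j') i i'
  simp only [Matrix.of_apply] at a1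
  rw [a1]
  refine Finset.sum_congr rfl fun α _ => ?_
  have a2 : ∀ k l, E k l j j' =
      ∑ β, (∑ m, ∑ n, E k l m n * K (Matrix.single m n 1) β) * D j j' β :=
    fun k l => hexp _ (h2 k l) j j'
  simp only [fun k l => a2 k l]
  generalize hG : (fun k l β => ∑ m, ∑ n, E k l m n * K (Matrix.single m n 1) β) = G
  have hG' : ∀ k l β, ∑ m, ∑ n, E k l m n * K (Matrix.single m n 1) β = G k l β := by
    intro k l β; rw [← hG]
  simp only [hG']
  have : ∀ β, D i i' α * D j j' β * ∑ k, ∑ l, G k l β * K (Matrix.single k l 1) α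
    = ∑ k, ∑ l, G k l β * D j j' β * K (Matrix.single k l 1) α * D i i' α := by
    intro β
    simp only [Finset.mul_sum]
    refine Finset.sum_congr rfl fun k _ => Finset.sum_congr rfl fun l _ => ?_
    ring
  simp only [this]
  simp only [Finset.sum_mul]
  conv_rhs => rw [Finset.sum_comm]
  refine Finset.sum_congr rfl fun k _ => ?_
  conv_rhs => rw [Finset.sum_comm]

lemma exists_class {E : (i i' j j' : Fin p → Fin d) → ℂ}
    (h : ∃ c : Equiv.Perm (Fin p) → Equiv.Perm (Fin p) → ℂ, ∀ i i' j j',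
      E i i' j j' = ∑ α, ∑ β, D i i' α * D j j' β * c α β)
    (hE : ∀ (σ τ : Equiv.Perm (Fin p)) i i' j j',
      E (i ∘ σ) (i' ∘ τ) (j ∘ σ) (j' ∘ τ) = E i i' j j')
    (hE' : ∀ i i' j j', E i' i j' j = (starRingEnd ℂ) (E i i' j j')) :
    ∃ W : Equiv.Perm (Fin p) → ℝ, (∀ σ τ, W (τ * σ * τ⁻¹) = W σ) ∧
      ∀ i i' j j', E i i' j j' = ∑ α, ∑ β, D i i' α * D j j' β * (W (α⁻¹ * β) : ℂ) := by
  obtain ⟨c, hc⟩ := h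
  let N : ℂ := (Fintype.card (Equiv.Perm (Fin p)) : ℂ)
  have hN : N ≠ 0 := by
    simp only [N]; exact_mod_cast Fintype.card_ne_zero
  let b : Equiv.Perm (Fin p) → Equiv.Perm (Fin p) → ℂ := fun α β =>
    (N⁻¹ * N⁻¹) * ∑ σ : Equiv.Perm (Fin p), ∑ τ : Equiv.Perm (Fin p), c (τ * α * σ) (τ * β * σ)
  have hshift : ∀ (σ τ : Equiv.Perm (Fin p)) i i' j j', E i i' j j' =
      ∑ α, ∑ β, D i i' α * D j j' β * c (τ * α * σ) (τ * β * σ) := by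
    intro σ τ i i' j j'
    rw [← hE σ τ⁻¹, hc]
    rw [← Equiv.sum_comp ((Equiv.mulLeft τ).trans (Equiv.mulRight σ))]
    refine Finset.sum_congr rfl fun α _ => ?_
    rw [← Equiv.sum_comp ((Equiv.mulLeft τ).trans (Equiv.mulRight σ))]
    refine Finset.sum_congr rfl fun β _ => ?_
    have hx : ∀ x : Equiv.Perm (Fin p), τ⁻¹ * (τ * x * σ) * σ⁻¹ = x := fun x => by group
    simp only [D_comp, Equiv.trans_apply, Equiv.coe_mulLeft, Equiv.coe_mulRight, hx]
  have hb : ∀ i i' j j', E i i' j j' = ∑ α, ∑ β, D i i' α * D j j' β * b α β := by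
    intro i i' j j'
    have e : N * N * E i i' j j' = ∑ σ : Equiv.Perm (Fin p), ∑ τ : Equiv.Perm (Fin p),
        ∑ α, ∑ β, D i i' α * D j j' β * c (τ * α * σ) (τ * β * σ) := by
      simp only [← hshift, Finset.sum_const, Finset.card_univ, nsmul_eq_mul]
      simp only [N]; ring
    have e2 : E i i' j j' = (N⁻¹ * N⁻¹) * (N * N * E i i' j j') := by
      field_simp
    rw [e2, e]
    simp only [b, Finset.mul_sum]
    calc _ = ∑ σ : Equiv.Perm (Fin p), ∑ α, ∑ τ : Equiv.Perm (Fin p), ∑ β,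
          N⁻¹ * N⁻¹ * (D i i' α * D j j' β * c (τ * α * σ) (τ * β * σ)) :=
          Finset.sum_congr rfl fun σ _ => Finset.sum_comm
      _ = ∑ α, ∑ σ : Equiv.Perm (Fin p), ∑ τ : Equiv.Perm (Fin p), ∑ β,
          N⁻¹ * N⁻¹ * (D i i' α * D j j' β * c (τ * α * σ) (τ * β * σ)) := Finset.sum_comm
      _ = ∑ α, ∑ σ : Equiv.Perm (Fin p), ∑ β, ∑ τ : Equiv.Perm (Fin p),
          N⁻¹ * N⁻¹ * (D i i' α * D j j' β * c (τ * α * σ) (τ * β * σ)) :=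
          Finset.sum_congr rfl fun α _ => Finset.sum_congr rfl fun σ _ => Finset.sum_comm
      _ = ∑ α, ∑ β, ∑ σ : Equiv.Perm (Fin p), ∑ τ : Equiv.Perm (Fin p),
          N⁻¹ * N⁻¹ * (D i i' α * D j j' β * c (τ * α * σ) (τ * β * σ)) :=
          Finset.sum_congr rfl fun α _ => Finset.sum_comm
      _ = _ := by
        refine Finset.sum_congr rfl fun α _ => Finset.sum_congr rfl fun β _ =>
          Finset.sum_congr rfl fun σ _ => Finset.sum_congr rfl fun τ _ => ?_
        ring
  have hbl : ∀ g α β, b (g * α) (g * β) = b α β := by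
    intro g α β
    simp only [b]
    congr 1
    refine Finset.sum_congr rfl fun σ _ => ?_
    conv_rhs => rw [← Equiv.sum_comp (Equiv.mulRight g)]
    simp [mul_assoc]
  have hbr : ∀ g α β, b (α * g) (β * g) = b α β := by
    intro g α β
    simp only [b]
    congr 1
    conv_rhs => rw [← Equiv.sum_comp (Equiv.mulLeft g)]
    simp [mul_assoc]
  have hb1 : ∀ α β, b α β = b 1 (α⁻¹ * β) := by
    intro α β
    rw [← hbl α⁻¹ α β, inv_mul_cancel]
  have hcl : ∀ σ τ, b 1 (τ * σ * τ⁻¹) = b 1 σ := by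
    intro σ τ
    rw [← hbl τ⁻¹, ← hbr τ]
    simp [mul_assoc]
  have hinv : ∀ σ, b 1 σ⁻¹ = b 1 σ := by
    intro σ
    have : IsConj σ σ⁻¹ := by
      rw [Equiv.Perm.isConj_iff_cycleType_eq, Equiv.Perm.cycleType_inv]
    obtain ⟨τ, hτ⟩ := isConj_iff.1 this
    rw [← hτ, hcl]
  have hDstar : ∀ (i i' : Fin p → Fin d) α, (starRingEnd ℂ) (D i i' α) = D i i' α := by
    intro i i' α
    rw [D_eq]; split_ifs <;> simp
  have hconj : ∀ i i' j j', E i i' j j' = ∑ α, ∑ β, D i i' α * D j j' β *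
      (starRingEnd ℂ) (b α β) := by
    intro i i' j j'
    rw [hE' i' i j' j, hb]
    simp only [map_sum, map_mul, hDstar]
    rw [← Equiv.sum_comp (Equiv.inv _)]
    refine Finset.sum_congr rfl fun α _ => ?_
    rw [← Equiv.sum_comp (Equiv.inv _)]
    refine Finset.sum_congr rfl fun β _ => ?_
    simp only [Equiv.inv_apply]
    rw [D_swap i i', D_swap j j', inv_inv, inv_inv]
    congr 2
    rw [hb1 α⁻¹, hb1 α β, ← hinv, ← hcl _ β⁻¹]
    simp
  refine ⟨fun σ => (b 1 σ).re, fun σ τ => by simp only [hcl], fun i i' j j' => ?_⟩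
  have : E i i' j j' = (1 / 2 : ℂ) * (E i i' j j' + E i i' j j') := by ring
  rw [this]
  conv_lhs => enter [2, 1]; rw [hb]
  conv_lhs => enter [2, 2]; rw [hconj]
  rw [← Finset.sum_add_distrib, Finset.mul_sum]
  refine Finset.sum_congr rfl fun α _ => ?_
  rw [← Finset.sum_add_distrib, Finset.mul_sum]
  refine Finset.sum_congr rfl fun β _ => ?_
  rw [hb1 α β, ← mul_add, Complex.add_conj]
  push_cast
  ring

variable (μ : Measure (Matrix.unitaryGroup (Fin d) ℂ))

/-- The Haar average. -/
noncomputable def EE (i i' j j' : Fin p → Fin d) : ℂ :=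
  ∫ U : Matrix.unitaryGroup (Fin d) ℂ,
    T p (U : Matrix (Fin d) (Fin d) ℂ) i j *
      (starRingEnd ℂ) (T p (U : Matrix (Fin d) (Fin d) ℂ) i' j') ∂μ

lemma continuous_T (i j : Fin p → Fin d) :
    Continuous fun U : Matrix.unitaryGroup (Fin d) ℂ => T p (U : Matrix (Fin d) (Fin d) ℂ) i j := by
  simp only [T_apply]
  refine continuous_finsetProd _ fun a _ => ?_
  exact (continuous_apply_apply (i a) (j a)).comp continuous_subtype_val

lemma norm_T_le (U : Matrix.unitaryGroup (Fin d) ℂ) (i j : Fin p → Fin d) :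
    ‖T p (U : Matrix (Fin d) (Fin d) ℂ) i j‖ ≤ 1 := by
  rw [T_apply, norm_prod]
  exact Finset.prod_le_one (fun _ _ => norm_nonneg _)
    fun a _ => entry_norm_bound_of_unitary U.2 _ _

lemma integrable_EE [IsProbabilityMeasure μ] (i i' j j' : Fin p → Fin d) :
    Integrable (fun U : Matrix.unitaryGroup (Fin d) ℂ =>
      T p (U : Matrix (Fin d) (Fin d) ℂ) i j *
      (starRingEnd ℂ) (T p (U : Matrix (Fin d) (Fin d) ℂ) i' j')) μ := by
  have hc : Continuous (fun U : Matrix.unitaryGroup (Fin d) ℂ =>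
      T p (U : Matrix (Fin d) (Fin d) ℂ) i j *
      (starRingEnd ℂ) (T p (U : Matrix (Fin d) (Fin d) ℂ) i' j')) :=
    (continuous_T i j).mul (Complex.continuous_conj.comp (continuous_T i' j'))
  refine Integrable.of_bound hc.measurable.aestronglyMeasurable 1 (Filter.Eventually.of_forall fun U => ?_)
  rw [norm_mul, RCLike.norm_conj]
  exact mul_le_one₀ (norm_T_le U i j) (norm_nonneg _) (norm_T_le U i' j')

lemma right_inv [μ.IsHaarMeasure] [IsProbabilityMeasure μ] : μ.IsMulRightInvariant := by
  have hcl : IsClosed ((Matrix.unitaryGroup (Fin d) ℂ : Submonoid _) :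
    Set (Matrix (Fin d) (Fin d) ℂ)) := isClosed_unitary
  have : LocallyCompactSpace (Matrix (Fin d) (Fin d) ℂ) :=
    inferInstanceAs (LocallyCompactSpace (Fin d → Fin d → ℂ))
  have : LocallyCompactSpace (Matrix.unitaryGroup (Fin d) ℂ) :=
    hcl.isClosedEmbedding_subtypeVal.locallyCompactSpace
  have : IsTopologicalGroup (Matrix.unitaryGroup (Fin d) ℂ) :=
    inferInstanceAs (IsTopologicalGroup (unitary (Matrix (Fin d) (Fin d) ℂ)))
  constructor
  intro g
  have : IsProbabilityMeasure (Measure.map (fun x => x * g) μ) :=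
    Measure.isProbabilityMeasure_map (continuous_mul_const g).measurable.aemeasurable
  exact Measure.isHaarMeasure_eq_of_isProbabilityMeasure _ _

lemma EE_left [μ.IsHaarMeasure] [IsProbabilityMeasure μ] (V : Matrix.unitaryGroup (Fin d) ℂ)
    (i i' j j' : Fin p → Fin d) :
    EE μ i i' j j' = ∑ k, ∑ k', T p (V : Matrix (Fin d) (Fin d) ℂ) i k *
      (starRingEnd ℂ) (T p (V : Matrix (Fin d) (Fin d) ℂ) i' k') * EE μ k k' j j' := by
  have : IsTopologicalGroup (Matrix.unitaryGroup (Fin d) ℂ) :=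
    inferInstanceAs (IsTopologicalGroup (unitary (Matrix (Fin d) (Fin d) ℂ)))
  simp only [EE]
  rw [← integral_mul_left_eq_self _ V]
  simp only [← integral_const_mul]
  have hint : ∀ k k', Integrable (fun U : Matrix.unitaryGroup (Fin d) ℂ =>
      T p (V : Matrix (Fin d) (Fin d) ℂ) i k *
      (starRingEnd ℂ) (T p (V : Matrix (Fin d) (Fin d) ℂ) i' k') *
      (T p (U : Matrix (Fin d) (Fin d) ℂ) k j *
      (starRingEnd ℂ) (T p (U : Matrix (Fin d) (Fin d) ℂ) k' j'))) μ :=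
    fun k k' => (integrable_EE μ k k' j j').const_mul _
  have e1 : ∀ k, ∑ k', ∫ U : Matrix.unitaryGroup (Fin d) ℂ,
      T p (V : Matrix (Fin d) (Fin d) ℂ) i k *
      (starRingEnd ℂ) (T p (V : Matrix (Fin d) (Fin d) ℂ) i' k') *
      (T p (U : Matrix (Fin d) (Fin d) ℂ) k j *
      (starRingEnd ℂ) (T p (U : Matrix (Fin d) (Fin d) ℂ) k' j')) ∂μ = _ :=
    fun k => (integral_finsetSum _ fun k' _ => hint k k').symm
  simp only [e1]
  rw [← integral_finsetSum _ fun k _ => integrable_finsetSum _ fun k' _ => hint k k']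
  refine integral_congr_ae (Filter.Eventually.of_forall fun U => ?_)
  simp only [Matrix.UnitaryGroup.mul_val, T_mul, Matrix.mul_apply, map_sum, map_mul,
    Finset.sum_mul_sum]
  refine Finset.sum_congr rfl fun k _ => Finset.sum_congr rfl fun k' _ => ?_
  ring

lemma EE_right [μ.IsHaarMeasure] [IsProbabilityMeasure μ] (V : Matrix.unitaryGroup (Fin d) ℂ)
    (i i' j j' : Fin p → Fin d) :
    EE μ i i' j j' = ∑ k, ∑ k', T p (V : Matrix (Fin d) (Fin d) ℂ) k j *
      (starRingEnd ℂ) (T p (V : Matrix (Fin d) (Fin d) ℂ) k' j') * EE μ i i' k k' := by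
  have : IsTopologicalGroup (Matrix.unitaryGroup (Fin d) ℂ) :=
    inferInstanceAs (IsTopologicalGroup (unitary (Matrix (Fin d) (Fin d) ℂ)))
  have := right_inv μ
  simp only [EE]
  rw [← integral_mul_right_eq_self _ V]
  simp only [← integral_const_mul]
  have hint : ∀ k k', Integrable (fun U : Matrix.unitaryGroup (Fin d) ℂ =>
      T p (V : Matrix (Fin d) (Fin d) ℂ) k j *
      (starRingEnd ℂ) (T p (V : Matrix (Fin d) (Fin d) ℂ) k' j') *
      (T p (U : Matrix (Fin d) (Fin d) ℂ) i k *
      (starRingEnd ℂ) (T p (U : Matrix (Fin d) (Fin d) ℂ) i' k'))) μ :=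
    fun k k' => (integrable_EE μ i i' k k').const_mul _
  have e1 : ∀ k, ∑ k', ∫ U : Matrix.unitaryGroup (Fin d) ℂ,
      T p (V : Matrix (Fin d) (Fin d) ℂ) k j *
      (starRingEnd ℂ) (T p (V : Matrix (Fin d) (Fin d) ℂ) k' j') *
      (T p (U : Matrix (Fin d) (Fin d) ℂ) i k *
      (starRingEnd ℂ) (T p (U : Matrix (Fin d) (Fin d) ℂ) i' k')) ∂μ = _ :=
    fun k => (integral_finsetSum _ fun k' _ => hint k k').symm
  simp only [e1]
  rw [← integral_finsetSum _ fun k _ => integrable_finsetSum _ fun k' _ => hint k k']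
  refine integral_congr_ae (Filter.Eventually.of_forall fun U => ?_)
  simp only [Matrix.UnitaryGroup.mul_val, T_mul, Matrix.mul_apply, map_sum, map_mul,
    Finset.sum_mul_sum]
  refine Finset.sum_congr rfl fun k _ => Finset.sum_congr rfl fun k' _ => ?_
  ring

lemma T_unitary {U : Matrix (Fin d) (Fin d) ℂ} (hU : U ∈ Matrix.unitaryGroup (Fin d) ℂ) :
    (T p U)ᴴ * T p U = 1 ∧ T p U * (T p U)ᴴ = 1 := by
  rw [← T_conjTranspose, ← T_mul, ← T_mul, ← Matrix.star_eq_conjTranspose,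
    Matrix.mem_unitaryGroup_iff'.1 hU, Matrix.mem_unitaryGroup_iff.1 hU, T_one]
  exact ⟨rfl, rfl⟩

lemma EE_mem_left [μ.IsHaarMeasure] [IsProbabilityMeasure μ] (j j' : Fin p → Fin d) :
    (Matrix.of fun i i' => EE μ i i' j j') ∈ LinearMap.range (L d p) := by
  apply mem_range_of_comm
  intro U hU
  set M := (Matrix.of fun i i' => EE μ i i' j j') with hM
  have h : M = T p U * M * (T p U)ᴴ := by
    ext i i'
    have := EE_left μ ⟨U, hU⟩ i i' j j'
    rw [hM, Matrix.of_apply, this]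
    simp only [Matrix.mul_apply, Matrix.conjTranspose_apply, Matrix.of_apply, Finset.sum_mul]
    rw [Finset.sum_comm]
    refine Finset.sum_congr rfl fun k _ => Finset.sum_congr rfl fun k' _ => ?_
    simp only [starRingEnd_apply]
    ring
  conv_rhs => rw [h]
  rw [mul_assoc, (T_unitary hU).1, mul_one]

lemma L_transpose (c : Equiv.Perm (Fin p) → ℂ) : (L d p c)ᵀ = L d p (fun α => c α⁻¹) := by
  ext i j
  rw [Matrix.transpose_apply, L_apply, L_apply, ← Equiv.sum_comp (Equiv.inv _)]
  refine Finset.sum_congr rfl fun α _ => ?_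
  rw [D_swap i j, Equiv.inv_apply, inv_inv]

lemma EE_mem_right [μ.IsHaarMeasure] [IsProbabilityMeasure μ] (i i' : Fin p → Fin d) :
    (Matrix.of fun j j' => EE μ i i' j j') ∈ LinearMap.range (L d p) := by
  set M := (Matrix.of fun j j' => EE μ i i' j j') with hM
  suffices h : Mᵀ ∈ LinearMap.range (L d p) by
    obtain ⟨c, hc⟩ := h
    rw [← Matrix.transpose_transpose M, ← hc, L_transpose]
    exact ⟨_, rfl⟩
  apply mem_range_of_comm
  intro U hU
  have h : Mᵀ = (T p U)ᴴ * Mᵀ * T p U := by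
    ext j' j
    have := EE_right μ ⟨U, hU⟩ i i' j j'
    rw [Matrix.transpose_apply, hM, Matrix.of_apply, this]
    simp only [Matrix.mul_apply, Matrix.conjTranspose_apply, Matrix.transpose_apply,
      Matrix.of_apply, Finset.sum_mul]
    refine Finset.sum_congr rfl fun k _ => Finset.sum_congr rfl fun k' _ => ?_
    simp only [starRingEnd_apply]
    ring
  conv_lhs => rw [h]
  rw [← mul_assoc, ← mul_assoc, (T_unitary hU).2, one_mul]

lemma T_perm (A : Matrix (Fin d) (Fin d) ℂ) (i j : Fin p → Fin d) (σ : Equiv.Perm (Fin p)) :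
    T p A (i ∘ σ) (j ∘ σ) = T p A i j := by
  rw [T_apply, T_apply]
  exact Equiv.prod_comp σ (fun a => A (i a) (j a))

end Wein

/-- The Weingarten formula: the Haar average of a balanced monomial of degree `p` in the
entries of a Haar-random unitary `U ∈ U(d)` and their conjugates is a sum over pairs of
permutations `α, β ∈ S_p` of products of Kronecker deltas, weighted by a class function
`Wg` (the Weingarten function). -/
theorem stmt_0 (d p : ℕ) (hd : 0 < d) (hp : 0 < p)
    (μ : Measure (Matrix.unitaryGroup (Fin d) ℂ))
    [μ.IsHaarMeasure] [IsProbabilityMeasure μ] :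
    ∃ Wg : Equiv.Perm (Fin p) → ℝ,
      (∀ σ τ : Equiv.Perm (Fin p), Wg (τ * σ * τ⁻¹) = Wg σ) ∧
      ∀ i i' j j' : Fin p → Fin d,
        ∫ U : Matrix.unitaryGroup (Fin d) ℂ,
            (∏ a : Fin p, (U : Matrix (Fin d) (Fin d) ℂ) (i a) (j a)) *
              ∏ a : Fin p,
                (starRingEnd ℂ) ((U : Matrix (Fin d) (Fin d) ℂ) (i' a) (j' a)) ∂μ
          = ∑ α : Equiv.Perm (Fin p), ∑ β : Equiv.Perm (Fin p),
              (∏ a : Fin p, if i a = i' (α a) then (1 : ℂ) else 0) *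
                (∏ a : Fin p, if j a = j' (β a) then (1 : ℂ) else 0) *
                (Wg (α⁻¹ * β) : ℂ) := by
  obtain ⟨W, hW, h⟩ := Wein.exists_class (E := Wein.EE (p := p) μ)
    (Wein.exists_coeff (Wein.EE_mem_left μ) (Wein.EE_mem_right μ))
    (fun σ τ i i' j j' => by simp only [Wein.EE, Wein.T_perm])
    (fun i i' j j' => by
      rw [Wein.EE, Wein.EE, ← integral_conj]
      refine integral_congr_ae (Filter.Eventually.of_forall fun U => ?_)
      simp only [map_mul, Complex.conj_conj]
      ring)
  refine ⟨W, hW, fun i i' j j' => ?_⟩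
  have := h i i' j j'
  simp only [Wein.EE, Wein.T_apply, map_prod, Wein.D] at this
  exact this
end

section
/- Let d be a positive integer. For all indices i, j, i', j' in {1,…,d}, the Haar average ∫_{U(d)} U_{ij} · conj(U_{i'j'}) dμ(U) equals δ_{i i'} δ_{j j'} / d. -/
open MeasureTheory Matrix

theorem aux_int (d : ℕ) (μ : Measure (Matrix.unitaryGroup (Fin d) ℂ))
    [IsProbabilityMeasure μ] (i j i' j' : Fin d) :
    Integrable (fun U : Matrix.unitaryGroup (Fin d) ℂ =>
        (U : Matrix (Fin d) (Fin d) ℂ) i j *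
          (starRingEnd ℂ) ((U : Matrix (Fin d) (Fin d) ℂ) i' j')) μ := by
  have hc : ∀ a b : Fin d, Continuous (fun U : Matrix.unitaryGroup (Fin d) ℂ =>
      (U : Matrix (Fin d) (Fin d) ℂ) a b) := fun a b =>
    continuous_subtype_val.matrix_elem a b
  have hcont := (hc i j).mul (Complex.continuous_conj.comp (hc i' j'))
  refine Integrable.of_bound (C := 1) hcont.aestronglyMeasurable (Filter.Eventually.of_forall ?_)
  intro U
  have h1 := entry_norm_bound_of_unitary U.2 i j
  have h2 := entry_norm_bound_of_unitary U.2 i' j'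
  rw [norm_mul, RCLike.norm_conj]
  exact mul_le_one₀ h1 (norm_nonneg _) h2

theorem stmt_2 (d : ℕ) (hd : 0 < d)
    (μ : Measure (Matrix.unitaryGroup (Fin d) ℂ))
    [μ.IsHaarMeasure] [IsProbabilityMeasure μ]
    (i j i' j' : Fin d) :
    ∫ U : Matrix.unitaryGroup (Fin d) ℂ,
        (U : Matrix (Fin d) (Fin d) ℂ) i j *
          (starRingEnd ℂ) ((U : Matrix (Fin d) (Fin d) ℂ) i' j') ∂μ
      = (if i = i' then 1 else 0) * (if j = j' then 1 else 0) / (d : ℂ) := by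
  classical
  by_cases hi : i = i'
  swap
  · have hD : Matrix.diagonal (fun k : Fin d => if k = i then (-1 : ℂ) else 1)
        ∈ Matrix.unitaryGroup (Fin d) ℂ := by
      rw [Matrix.mem_unitaryGroup_iff, Matrix.star_eq_conjTranspose,
        Matrix.diagonal_conjTranspose, Matrix.diagonal_mul_diagonal, ← Matrix.diagonal_one]
      congr 1
      funext k
      by_cases hk : k = i <;> simp [hk]
    have h := integral_mul_left_eq_self (μ := μ)
      (fun U : Matrix.unitaryGroup (Fin d) ℂ =>
        (U : Matrix (Fin d) (Fin d) ℂ) i j *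
          (starRingEnd ℂ) ((U : Matrix (Fin d) (Fin d) ℂ) i' j')) ⟨_, hD⟩
    have hi2 : ¬ i' = i := fun e => hi e.symm
    simp only [Submonoid.coe_mul, Matrix.diagonal_mul, if_true, hi2, if_false, one_mul,
      neg_mul, integral_neg] at h
    simp only [hi, if_false, zero_mul, zero_div]
    exact self_eq_neg.mp h.symm
  subst hi
  have key : ∀ k : Fin d, ∫ U : Matrix.unitaryGroup (Fin d) ℂ,
        (U : Matrix (Fin d) (Fin d) ℂ) k j *
          (starRingEnd ℂ) ((U : Matrix (Fin d) (Fin d) ℂ) k j') ∂μ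
      = ∫ U : Matrix.unitaryGroup (Fin d) ℂ,
        (U : Matrix (Fin d) (Fin d) ℂ) i j *
          (starRingEnd ℂ) ((U : Matrix (Fin d) (Fin d) ℂ) i j') ∂μ := by
    intro k
    have hP : (Matrix.of fun a b : Fin d => if Equiv.swap i k a = b then (1 : ℂ) else 0)
        ∈ Matrix.unitaryGroup (Fin d) ℂ := by
      rw [Matrix.mem_unitaryGroup_iff, Matrix.star_eq_conjTranspose]
      ext a b
      simp [Matrix.mul_apply, Matrix.one_apply, apply_ite, eq_comm]
    have h := integral_mul_left_eq_self (μ := μ)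
      (fun U : Matrix.unitaryGroup (Fin d) ℂ =>
        (U : Matrix (Fin d) (Fin d) ℂ) i j *
          (starRingEnd ℂ) ((U : Matrix (Fin d) (Fin d) ℂ) i j')) ⟨_, hP⟩
    rw [← h]
    congr 1
    funext U
    simp [Matrix.mul_apply]
  have hsum : ∑ k : Fin d, ∫ U : Matrix.unitaryGroup (Fin d) ℂ,
        (U : Matrix (Fin d) (Fin d) ℂ) k j *
          (starRingEnd ℂ) ((U : Matrix (Fin d) (Fin d) ℂ) k j') ∂μ
      = if j = j' then 1 else 0 := by
    rw [← integral_finset_sum _ (fun k _ => aux_int d μ k j k j')]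
    have : ∀ U : Matrix.unitaryGroup (Fin d) ℂ,
        ∑ k : Fin d, (U : Matrix (Fin d) (Fin d) ℂ) k j *
          (starRingEnd ℂ) ((U : Matrix (Fin d) (Fin d) ℂ) k j')
        = if j = j' then 1 else 0 := by
      intro U
      have hU := congrFun (congrFun (Matrix.mem_unitaryGroup_iff'.mp U.2) j') j
      rw [Matrix.mul_apply, Matrix.one_apply] at hU
      simp only [eq_comm (a := j) (b := j')]
      rw [← hU]
      refine Finset.sum_congr rfl fun k _ => ?_
      rw [Matrix.star_apply, mul_comm]
      rfl
    simp [this]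
  rw [Finset.sum_congr rfl (fun k _ => key k)] at hsum
  simp only [Finset.sum_const, Finset.card_univ, Fintype.card_fin, nsmul_eq_mul] at hsum
  have hd0 : (d : ℂ) ≠ 0 := by exact_mod_cast hd.ne'
  rw [eq_div_iff hd0, mul_comm, hsum]
  simp
end

section
/- Let d ≥ 2 be an integer. For all indices i_1, i_2, i'_1, i'_2, j_1, j_2, j'_1, j'_2 in {1,…,d}, the Haar average ∫_{U(d)} U_{i_1 j_1} U_{i_2 j_2} · conj(U_{i'_1 j'_1}) conj(U_{i'_2 j'_2}) dμ(U) equals (δ_{i_1 i'_1}δ_{i_2 i'_2}δ_{j_1 j'_1}δ_{j_2 j'_2} + δ_{i_1 i'_2}δ_{i_2 i'_1}δ_{j_1 j'_2}δ_{j_2 j'_1})/(d²−1) − (δ_{i_1 i'_1}δ_{i_2 i'_2}δ_{j_1 j'_2}δ_{j_2 j'_1} + δ_{i_1 i'_2}δ_{i_2 i'_1}δ_{j_1 j'_1}δ_{j_2 j'_2})/(d(d²−1)). -/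
open MeasureTheory Matrix

noncomputable abbrev WT {d : ℕ} (μ : Measure (Matrix.unitaryGroup (Fin d) ℂ)) (j₁ j₂ j'₁ j'₂ : Fin d)
    (a b c e : Fin d) : ℂ :=
  ∫ U : Matrix.unitaryGroup (Fin d) ℂ,
        (U : Matrix (Fin d) (Fin d) ℂ) a j₁ * (U : Matrix (Fin d) (Fin d) ℂ) b j₂ *
          (starRingEnd ℂ) ((U : Matrix (Fin d) (Fin d) ℂ) c j'₁) *
          (starRingEnd ℂ) ((U : Matrix (Fin d) (Fin d) ℂ) e j'₂) ∂μ

section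
variable {d : ℕ} (μ : Measure (Matrix.unitaryGroup (Fin d) ℂ))
    [μ.IsHaarMeasure] [IsProbabilityMeasure μ] (j₁ j₂ j'₁ j'₂ : Fin d)

lemma w_int (a b c e : Fin d) : Integrable (fun U : Matrix.unitaryGroup (Fin d) ℂ =>
        (U : Matrix (Fin d) (Fin d) ℂ) a j₁ * (U : Matrix (Fin d) (Fin d) ℂ) b j₂ *
          (starRingEnd ℂ) ((U : Matrix (Fin d) (Fin d) ℂ) c j'₁) *
          (starRingEnd ℂ) ((U : Matrix (Fin d) (Fin d) ℂ) e j'₂)) μ := by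
  have hc : ∀ x y : Fin d, Continuous (fun U : Matrix.unitaryGroup (Fin d) ℂ =>
      (U : Matrix (Fin d) (Fin d) ℂ) x y) := fun x y =>
    (continuous_subtype_val).matrix_elem x y
  refine Integrable.of_bound (C := 1) (Continuous.aestronglyMeasurable ?_) ?_
  · exact (((hc _ _).mul (hc _ _)).mul (Complex.continuous_conj.comp (hc _ _))).mul
      (Complex.continuous_conj.comp (hc _ _))
  · refine Filter.Eventually.of_forall fun U => ?_
    have hb : ∀ x y, ‖(U : Matrix (Fin d) (Fin d) ℂ) x y‖ ≤ 1 :=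
      fun x y => entry_norm_bound_of_unitary U.2 x y
    simp only [norm_mul, RCLike.norm_conj]
    have := hb a j₁
    have := hb b j₂
    have := hb c j'₁
    have := hb e j'₂
    exact mul_le_one₀ (mul_le_one₀ (mul_le_one₀ (by assumption) (norm_nonneg _) (by assumption))
      (norm_nonneg _) (by assumption)) (norm_nonneg _) (by assumption)

lemma w_inv (V : Matrix.unitaryGroup (Fin d) ℂ) (a b c e : Fin d) :
    WT μ j₁ j₂ j'₁ j'₂ a b c e = ∫ U : Matrix.unitaryGroup (Fin d) ℂ,
        ((V : Matrix (Fin d) (Fin d) ℂ) * (U : Matrix (Fin d) (Fin d) ℂ)) a j₁ *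
        ((V : Matrix (Fin d) (Fin d) ℂ) * (U : Matrix (Fin d) (Fin d) ℂ)) b j₂ *
          (starRingEnd ℂ) (((V : Matrix (Fin d) (Fin d) ℂ) * (U : Matrix (Fin d) (Fin d) ℂ)) c j'₁) *
          (starRingEnd ℂ) (((V : Matrix (Fin d) (Fin d) ℂ) * (U : Matrix (Fin d) (Fin d) ℂ)) e j'₂) ∂μ := by
  rw [WT, ← integral_mul_left_eq_self _ V]
  rfl

noncomputable def wph (m i : Fin d) : ℂ := if i = m then Complex.I else 1

lemma w_diag (m a b c e : Fin d) :
    WT μ j₁ j₂ j'₁ j'₂ a b c e = wph m a * wph m b * star (wph m c) * star (wph m e) *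
      WT μ j₁ j₂ j'₁ j'₂ a b c e := by
  have hV : Matrix.diagonal (wph m) ∈ Matrix.unitaryGroup (Fin d) ℂ := by
    rw [Matrix.mem_unitaryGroup_iff, Matrix.star_eq_conjTranspose, Matrix.diagonal_conjTranspose,
      Matrix.diagonal_mul_diagonal, ← Matrix.diagonal_one]
    congr 1
    ext i
    simp only [wph, Pi.star_apply]
    split_ifs <;> simp
  conv_lhs => rw [w_inv μ j₁ j₂ j'₁ j'₂ ⟨_, hV⟩]
  rw [WT, ← integral_const_mul]
  congr 1
  ext U
  simp only [Matrix.diagonal_mul, map_mul, starRingEnd_apply]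
  ring

lemma w_swap_mul (k l : Fin d) (U : Matrix (Fin d) (Fin d) ℂ) (i j : Fin d) :
    (Matrix.swap ℂ k l * U) i j = U (Equiv.swap k l i) j := by
  simp [Matrix.swap, Matrix.mul_apply, Equiv.Perm.permMatrix, PEquiv.toMatrix_apply]

lemma w_swap_star (k l : Fin d) : star (Matrix.swap ℂ k l) = Matrix.swap ℂ k l := by
  rw [Matrix.star_eq_conjTranspose]
  simp

lemma w_swap (k l a b c e : Fin d) :
    WT μ j₁ j₂ j'₁ j'₂ a b c e = WT μ j₁ j₂ j'₁ j'₂ (Equiv.swap k l a) (Equiv.swap k l b)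
      (Equiv.swap k l c) (Equiv.swap k l e) := by
  have hV : Matrix.swap ℂ k l ∈ Matrix.unitaryGroup (Fin d) ℂ := by
    rw [Matrix.mem_unitaryGroup_iff, w_swap_star, Matrix.swap_mul_self]
  rw [w_inv μ j₁ j₂ j'₁ j'₂ ⟨_, hV⟩]
  simp only [w_swap_mul]

lemma w_zero (a b c e : Fin d) (h : ¬ ((a = c ∧ b = e) ∨ (a = e ∧ b = c))) :
    WT μ j₁ j₂ j'₁ j'₂ a b c e = 0 := by
  have key : ∀ z T : ℂ, T = z * T → z ≠ 1 → T = 0 := by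
    intro z T h hz
    have : (z - 1) * T = 0 := by linear_combination -h
    exact (mul_eq_zero.1 this).resolve_left (sub_ne_zero.2 hz)
  have hI : Complex.I ≠ 1 := by intro h; simpa using congrArg Complex.re h
  have hI' : -Complex.I ≠ 1 := by intro h; simpa using congrArg Complex.re h
  have h2 : (-1 : ℂ) ≠ 1 := by norm_num
  have H1 := fun m => key _ _ (w_diag μ j₁ j₂ j'₁ j'₂ m a b c e)
  by_cases h1 : a = c
  · subst h1
    have hbe : b ≠ e := by tauto
    apply H1 b
    simp only [wph]
    by_cases hab : a = b <;> simp [hab, hbe.symm, hI]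
  by_cases h2' : a = e
  · subst h2'
    have hbe : b ≠ c := by tauto
    apply H1 b
    simp only [wph]
    by_cases hab : a = b <;> simp [hab, hbe.symm, hI]
  apply H1 a
  simp only [wph]
  by_cases hab : b = a <;> simp [hab, Ne.symm h1, Ne.symm h2', hI, h2]

set_option maxHeartbeats 1000000 in
lemma w_mix (k l : Fin d) (hkl : k ≠ l) :
    WT μ j₁ j₂ j'₁ j'₂ k k k k = 
      (1/4) * (WT μ j₁ j₂ j'₁ j'₂ k k k k + WT μ j₁ j₂ j'₁ j'₂ l l l l +
      WT μ j₁ j₂ j'₁ j'₂ k l k l + WT μ j₁ j₂ j'₁ j'₂ l k l k +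
      WT μ j₁ j₂ j'₁ j'₂ k l l k + WT μ j₁ j₂ j'₁ j'₂ l k k l) := by
  obtain ⟨α, hα⟩ : ∃ α : ℂ, α = (1 + Complex.I) / 2 := ⟨_, rfl⟩
  obtain ⟨β, hβ⟩ : ∃ β : ℂ, β = (1 - Complex.I) / 2 := ⟨_, rfl⟩
  have sα : star α = β := by simp [hα, hβ, sub_eq_add_neg]
  have sβ : star β = α := by simp [hα, hβ]
  have hI := Complex.I_mul_I
  have hab : α * β = 1 / 2 := by rw [hα, hβ]; linear_combination -(1/4) * hI
  have haabb : α * α + β * β = 0 := by rw [hα, hβ]; linear_combination (1/2) * hI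
  have hV : α • (1 : Matrix (Fin d) (Fin d) ℂ) + β • Matrix.swap ℂ k l
      ∈ Matrix.unitaryGroup (Fin d) ℂ := by
    rw [Matrix.mem_unitaryGroup_iff, star_add, star_smul, star_smul, w_swap_star, star_one, sα, sβ]
    simp only [add_mul, mul_add, smul_mul_smul_comm, mul_one, one_mul, Matrix.swap_mul_self]
    have : (α * β) • (1 : Matrix (Fin d) (Fin d) ℂ) + (β * β) • Matrix.swap ℂ k l +
      ((α * α) • Matrix.swap ℂ k l + (β * α) • 1) = (2 * (α * β)) • 1 +
        (α * α + β * β) • Matrix.swap ℂ k l := by module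
    rw [this, hab, haabb]; simp
  refine (w_inv μ j₁ j₂ j'₁ j'₂ ⟨_, hV⟩ k k k k).trans ?_
  have i := w_int μ j₁ j₂ j'₁ j'₂
  have Z := w_zero μ j₁ j₂ j'₁ j'₂
  have expand : ∀ p q r s p' q' r' s' : ℂ,
    (α * p + β * p') * (α * q + β * q') * (β * r + α * r') * (β * s + α * s') =
      (1/4) * (p*q*r*s) + (1/4) * (p'*q'*r'*s') + (1/4) * (p*q'*r*s') + (1/4) * (p'*q*r'*s)
      + (1/4) * (p*q'*r'*s) + (1/4) * (p'*q*r*s') 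
      + (α*α*β*α) * (p*q*r*s') + (α*α*β*α) * (p*q*r'*s) + (α*α*α*α) * (p*q*r'*s')
      + (α*β*β*β) * (p*q'*r*s) + (α*β*β*β) * (p'*q*r*s)
      + (α*β*α*α) * (p*q'*r'*s') + (α*β*α*α) * (p'*q*r'*s')
      + (β*β*β*β) * (p'*q'*r*s) + (β*β*α*β) * (p'*q'*r'*s) + (β*β*α*β) * (p'*q'*r*s') := by
    intro p q r s p' q' r' s'
    have h2 : α * α * (β * β) = 1/4 := by
      linear_combination (α * β + 1/2) * hab
    rw [← h2]; ring
  have sα' : (starRingEnd ℂ) α = β := sα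
  have sβ' : (starRingEnd ℂ) β = α := sβ
  have row : ∀ (U : Matrix (Fin d) (Fin d) ℂ) (j : Fin d),
      ((α • (1 : Matrix (Fin d) (Fin d) ℂ) + β • Matrix.swap ℂ k l) * U) k j
        = α * U k j + β * U l j := by
    intro U j
    rw [add_mul, Matrix.add_apply, smul_mul_assoc, smul_mul_assoc, one_mul, Matrix.smul_apply,
      Matrix.smul_apply, w_swap_mul, Equiv.swap_apply_left, smul_eq_mul, smul_eq_mul]
  simp only [row, map_add, map_mul, sα', sβ', expand]
  have hlk := hkl.symm
  have ic := fun (z : ℂ) a b c e => (i a b c e).const_mul z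
  have add2 : ∀ (F G : Matrix.unitaryGroup (Fin d) ℂ → ℂ) (x y : ℂ),
      (Integrable F μ ∧ ∫ U, F U ∂μ = x) → (Integrable G μ ∧ ∫ U, G U ∂μ = y) →
      (Integrable (fun U => F U + G U) μ ∧ ∫ U, (F U + G U) ∂μ = x + y) := by
    rintro F G x y ⟨hF, rfl⟩ ⟨hG, rfl⟩
    exact ⟨hF.add hG, integral_add hF hG⟩
  have mono : ∀ (z : ℂ) (a b c e : Fin d), 
      (Integrable (fun U : Matrix.unitaryGroup (Fin d) ℂ => z * (
        (U : Matrix (Fin d) (Fin d) ℂ) a j₁ * (U : Matrix (Fin d) (Fin d) ℂ) b j₂ *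
          (starRingEnd ℂ) ((U : Matrix (Fin d) (Fin d) ℂ) c j'₁) *
          (starRingEnd ℂ) ((U : Matrix (Fin d) (Fin d) ℂ) e j'₂))) μ ∧
       ∫ U : Matrix.unitaryGroup (Fin d) ℂ, z * (
        (U : Matrix (Fin d) (Fin d) ℂ) a j₁ * (U : Matrix (Fin d) (Fin d) ℂ) b j₂ *
          (starRingEnd ℂ) ((U : Matrix (Fin d) (Fin d) ℂ) c j'₁) *
          (starRingEnd ℂ) ((U : Matrix (Fin d) (Fin d) ℂ) e j'₂)) ∂μ =
        z * WT μ j₁ j₂ j'₁ j'₂ a b c e) :=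
    fun z a b c e => ⟨ic z a b c e, integral_const_mul _ _⟩
  have M1 := add2 _ _ _ _ (mono (1/4) k k k k) (mono (1/4) l l l l)
  have M2 := add2 _ _ _ _ M1 (mono (1/4) k l k l)
  have M3 := add2 _ _ _ _ M2 (mono (1/4) l k l k)
  have M4 := add2 _ _ _ _ M3 (mono (1/4) k l l k)
  have M5 := add2 _ _ _ _ M4 (mono (1/4) l k k l)
  have M6 := add2 _ _ _ _ M5 (mono (α*α*β*α) k k k l)
  have M7 := add2 _ _ _ _ M6 (mono (α*α*β*α) k k l k)
  have M8 := add2 _ _ _ _ M7 (mono (α*α*α*α) k k l l)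
  have M9 := add2 _ _ _ _ M8 (mono (α*β*β*β) k l k k)
  have N1 := add2 _ _ _ _ M9 (mono (α*β*β*β) l k k k)
  have N2 := add2 _ _ _ _ N1 (mono (α*β*α*α) k l l l)
  have N3 := add2 _ _ _ _ N2 (mono (α*β*α*α) l k l l)
  have N4 := add2 _ _ _ _ N3 (mono (β*β*β*β) l l k k)
  have N5 := add2 _ _ _ _ N4 (mono (β*β*α*β) l l l k)
  have N6 := add2 _ _ _ _ N5 (mono (β*β*α*β) l l k l)
  refine N6.2.trans ?_
  rw [Z k k k l (by grind), Z k k l k (by grind), Z k k l l (by grind), Z k l k k (by grind),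
    Z l k k k (by grind), Z k l l l (by grind), Z l k l l (by grind), Z l l k k (by grind),
    Z l l l k (by grind), Z l l k l (by grind)]
  ring

lemma w_form (hd : 2 ≤ d) : ∃ A B : ℂ, ∀ a b c e : Fin d, WT μ j₁ j₂ j'₁ j'₂ a b c e =
    A * ((if a = c then 1 else 0) * (if b = e then 1 else 0)) +
    B * ((if a = e then 1 else 0) * (if b = c then 1 else 0)) := by
  let z : Fin d := ⟨0, by omega⟩
  let o : Fin d := ⟨1, by omega⟩
  have hzo : z ≠ o := by simp [z, o]
  have red : ∀ a b : Fin d, a ≠ b → ∃ f : Equiv.Perm (Fin d), f a = z ∧ f b = o ∧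
      ∀ p q r s, WT μ j₁ j₂ j'₁ j'₂ p q r s = WT μ j₁ j₂ j'₁ j'₂ (f p) (f q) (f r) (f s) := by
    intro a b hab
    refine ⟨Equiv.swap (Equiv.swap a z b) o * Equiv.swap a z, ?_, ?_, ?_⟩
    · rw [Equiv.Perm.mul_apply, Equiv.swap_apply_left]
      apply Equiv.swap_apply_of_ne_of_ne _ hzo
      intro h
      apply hab
      apply (Equiv.swap a z).injective
      rw [← h, Equiv.swap_apply_left]
    · rw [Equiv.Perm.mul_apply, Equiv.swap_apply_left]
    · intro p q r s
      rw [w_swap μ j₁ j₂ j'₁ j'₂ a z, w_swap μ j₁ j₂ j'₁ j'₂ (Equiv.swap a z b) o]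
      rfl
  have hA : ∀ a b, a ≠ b → WT μ j₁ j₂ j'₁ j'₂ a b a b = WT μ j₁ j₂ j'₁ j'₂ z o z o := by
    intro a b hab
    obtain ⟨f, h1, h2, h3⟩ := red a b hab
    rw [h3, h1, h2]
  have hB : ∀ a b, a ≠ b → WT μ j₁ j₂ j'₁ j'₂ a b b a = WT μ j₁ j₂ j'₁ j'₂ z o o z := by
    intro a b hab
    obtain ⟨f, h1, h2, h3⟩ := red a b hab
    rw [h3, h1, h2]
  have hC : ∀ a, WT μ j₁ j₂ j'₁ j'₂ a a a a =
      WT μ j₁ j₂ j'₁ j'₂ z o z o + WT μ j₁ j₂ j'₁ j'₂ z o o z := by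
    intro a
    obtain ⟨b, hb⟩ : ∃ b, a ≠ b := by
      by_cases h : a = z
      · exact ⟨o, h ▸ hzo⟩
      · exact ⟨z, h⟩
    have h1 := w_mix μ j₁ j₂ j'₁ j'₂ a b hb
    have h2 := w_swap μ j₁ j₂ j'₁ j'₂ a b a a a a
    rw [Equiv.swap_apply_left] at h2
    rw [hA a b hb, hA b a hb.symm, hB a b hb, hB b a hb.symm, ← h2] at h1
    linear_combination 2 * h1
  refine ⟨WT μ j₁ j₂ j'₁ j'₂ z o z o, WT μ j₁ j₂ j'₁ j'₂ z o o z, ?_⟩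
  intro a b c e
  by_cases h : ((a = c ∧ b = e) ∨ (a = e ∧ b = c))
  · by_cases hab : a = b
    · subst hab
      have : c = a ∧ e = a := by grind
      obtain ⟨rfl, rfl⟩ := this
      rw [hC]; simp
    · rcases h with ⟨rfl, rfl⟩ | ⟨rfl, rfl⟩
      · rw [hA _ _ hab]; simp [hab]
      · rw [hB _ _ hab]; simp [hab]
  · rw [w_zero μ j₁ j₂ j'₁ j'₂ a b c e h]
    split_ifs <;> simp <;> tauto

lemma w_col (U : Matrix.unitaryGroup (Fin d) ℂ) (j j' : Fin d) :
    ∑ a, (U : Matrix (Fin d) (Fin d) ℂ) a j *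
      (starRingEnd ℂ) ((U : Matrix (Fin d) (Fin d) ℂ) a j') = if j = j' then 1 else 0 := by
  have h := congrFun (congrFun (Matrix.mem_unitaryGroup_iff'.1 U.2) j') j
  rw [Matrix.mul_apply, Matrix.one_apply] at h
  simp only [eq_comm (a := j), ← h]
  refine Finset.sum_congr rfl fun a _ => ?_
  rw [mul_comm]; rfl

lemma integral_const_one (z : ℂ) : ∫ _U : Matrix.unitaryGroup (Fin d) ℂ, z ∂μ = z := by
  simp

lemma w_sum1 : ∑ a, ∑ b, WT μ j₁ j₂ j'₁ j'₂ a b a b =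
    (if j₁ = j'₁ then 1 else 0) * (if j₂ = j'₂ then 1 else 0) := by
  have hi := w_int μ j₁ j₂ j'₁ j'₂
  simp only [WT]
  simp only [← integral_finsetSum _ (fun b _ => hi _ b _ b)]
  rw [← integral_finsetSum _ (fun a _ => integrable_finsetSum _ (fun b _ => hi a b a b))]
  rw [← integral_const_one μ ((if j₁ = j'₁ then (1:ℂ) else 0) * (if j₂ = j'₂ then 1 else 0))]
  congr 1
  ext U
  rw [← w_col U, ← w_col U, Finset.sum_mul_sum]
  refine Finset.sum_congr rfl fun a _ => Finset.sum_congr rfl fun b _ => ?_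
  ring

lemma w_sum2 : ∑ a, ∑ b, WT μ j₁ j₂ j'₁ j'₂ a b b a =
    (if j₁ = j'₂ then 1 else 0) * (if j₂ = j'₁ then 1 else 0) := by
  have hi := w_int μ j₁ j₂ j'₁ j'₂
  simp only [WT]
  simp only [← integral_finsetSum _ (fun b _ => hi _ b b _)]
  rw [← integral_finsetSum _ (fun a _ => integrable_finsetSum _ (fun b _ => hi a b b a))]
  rw [← integral_const_one μ ((if j₁ = j'₂ then (1:ℂ) else 0) * (if j₂ = j'₁ then 1 else 0))]
  congr 1
  ext U
  rw [← w_col U, ← w_col U, Finset.sum_mul_sum]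
  refine Finset.sum_congr rfl fun a _ => Finset.sum_congr rfl fun b _ => ?_
  ring
end

/-- The explicit Weingarten formula for second moments (`p = 2`) of Haar-unitary entries. -/
theorem stmt_3 (d : ℕ) (hd : 2 ≤ d)
    (μ : Measure (Matrix.unitaryGroup (Fin d) ℂ))
    [μ.IsHaarMeasure] [IsProbabilityMeasure μ]
    (i₁ i₂ i'₁ i'₂ j₁ j₂ j'₁ j'₂ : Fin d) :
    (∫ U : Matrix.unitaryGroup (Fin d) ℂ,
        (U : Matrix (Fin d) (Fin d) ℂ) i₁ j₁ * (U : Matrix (Fin d) (Fin d) ℂ) i₂ j₂ *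
          (starRingEnd ℂ) ((U : Matrix (Fin d) (Fin d) ℂ) i'₁ j'₁) *
          (starRingEnd ℂ) ((U : Matrix (Fin d) (Fin d) ℂ) i'₂ j'₂) ∂μ)
      = ((if i₁ = i'₁ then (1:ℂ) else 0) * (if i₂ = i'₂ then 1 else 0) *
            (if j₁ = j'₁ then 1 else 0) * (if j₂ = j'₂ then 1 else 0) +
          (if i₁ = i'₂ then (1:ℂ) else 0) * (if i₂ = i'₁ then 1 else 0) *
            (if j₁ = j'₂ then 1 else 0) * (if j₂ = j'₁ then 1 else 0)) / ((d : ℂ)^2 - 1)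
        - ((if i₁ = i'₁ then (1:ℂ) else 0) * (if i₂ = i'₂ then 1 else 0) *
            (if j₁ = j'₂ then 1 else 0) * (if j₂ = j'₁ then 1 else 0) +
          (if i₁ = i'₂ then (1:ℂ) else 0) * (if i₂ = i'₁ then 1 else 0) *
            (if j₁ = j'₁ then 1 else 0) * (if j₂ = j'₂ then 1 else 0)) /
          ((d : ℂ) * ((d : ℂ)^2 - 1)) := by
  obtain ⟨A, B, h⟩ := w_form μ j₁ j₂ j'₁ j'₂ hd
  have s1 := w_sum1 μ j₁ j₂ j'₁ j'₂
  have s2 := w_sum2 μ j₁ j₂ j'₁ j'₂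
  have q1 : ∑ a : Fin d, ∑ b : Fin d, WT μ j₁ j₂ j'₁ j'₂ a b a b = A * d ^ 2 + B * d := by
    simp only [h]
    simp [Finset.sum_add_distrib]; ring
  have q2 : ∑ a : Fin d, ∑ b : Fin d, WT μ j₁ j₂ j'₁ j'₂ a b b a = A * d + B * d ^ 2 := by
    simp only [h]
    simp [Finset.sum_add_distrib]; ring
  rw [q1] at s1
  rw [q2] at s2
  have hT := h i₁ i₂ i'₁ i'₂
  rw [WT] at hT
  rw [hT]
  have hd0 : (d : ℂ) ≠ 0 := by
    have : d ≠ 0 := by omega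
    exact_mod_cast this
  have hd1 : (d : ℂ) ^ 2 - 1 ≠ 0 := by
    intro h0
    have h1 : (d : ℂ) ^ 2 = 1 := by linear_combination h0
    have h2 : d ^ 2 = 1 := by exact_mod_cast h1
    nlinarith
  have eA : A = ((if j₁ = j'₁ then 1 else 0) * (if j₂ = j'₂ then 1 else 0)) / ((d : ℂ)^2 - 1)
      - ((if j₁ = j'₂ then 1 else 0) * (if j₂ = j'₁ then 1 else 0)) / ((d : ℂ) * ((d : ℂ)^2 - 1)) := by
    rw [← s1, ← s2]; field_simp; ring
  have eB : B = ((if j₁ = j'₂ then 1 else 0) * (if j₂ = j'₁ then 1 else 0)) / ((d : ℂ)^2 - 1)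
      - ((if j₁ = j'₁ then 1 else 0) * (if j₂ = j'₂ then 1 else 0)) / ((d : ℂ) * ((d : ℂ)^2 - 1)) := by
    rw [← s1, ← s2]; field_simp; ring
  rw [eA, eB]
  ring
end

section
/- Let d be a positive integer and let X, Y be d×d complex matrices. Then ∫_{U(d)} Tr(X U Y U*) dμ(U) = Tr(X) · Tr(Y) / d. -/
open MeasureTheory Matrix

open scoped Matrix.Norms.L2Operator in
theorem span_u_aux (d : ℕ) : Submodule.span ℂ
    (unitary (Matrix (Fin d) (Fin d) ℂ) : Set (Matrix (Fin d) (Fin d) ℂ)) = ⊤ :=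
  CStarAlgebra.span_unitary _

theorem integrable_aux (d : ℕ) (μ : Measure (Matrix.unitaryGroup (Fin d) ℂ))
    [IsProbabilityMeasure μ] (Y : Matrix (Fin d) (Fin d) ℂ) (i j : Fin d) :
    Integrable (fun U : Matrix.unitaryGroup (Fin d) ℂ =>
      ((U : Matrix (Fin d) (Fin d) ℂ) * Y * (U : Matrix (Fin d) (Fin d) ℂ)ᴴ) i j) μ := by
  have hc : ∀ i j, Continuous (fun U : Matrix.unitaryGroup (Fin d) ℂ =>
      (U : Matrix (Fin d) (Fin d) ℂ) i j) := fun i j =>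
    continuous_subtype_val.matrix_elem i j
  simp only [Matrix.mul_apply, Finset.sum_mul, Matrix.conjTranspose_apply]
  refine integrable_finsetSum _ fun k _ => integrable_finsetSum _ fun l _ => ?_
  refine Integrable.of_bound (C := ‖Y l k‖) ?_ (ae_of_all _ fun U => ?_)
  · exact (((hc _ _).mul continuous_const).mul (hc _ _).star).aestronglyMeasurable
  · have h1 := entry_norm_bound_of_unitary U.2 i l
    have h2 := entry_norm_bound_of_unitary U.2 j k
    rw [norm_mul, norm_mul, norm_star]
    calc _ ≤ 1 * ‖Y l k‖ * 1 := by gcongr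
      _ = _ := by ring

/-- `∫_{U(d)} Tr(X U Y U*) dμ(U) = Tr(X) Tr(Y) / d`. -/
theorem stmt_7 (d : ℕ) (hd : 0 < d)
    (μ : Measure (Matrix.unitaryGroup (Fin d) ℂ))
    [μ.IsHaarMeasure] [IsProbabilityMeasure μ]
    (X Y : Matrix (Fin d) (Fin d) ℂ) :
    ∫ U : Matrix.unitaryGroup (Fin d) ℂ,
        (X * (U : Matrix (Fin d) (Fin d) ℂ) * Y * (U : Matrix (Fin d) (Fin d) ℂ)ᴴ).trace ∂μ
      = X.trace * Y.trace / (d : ℂ) := by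
  set M : Matrix (Fin d) (Fin d) ℂ := Matrix.of fun i j =>
    ∫ U : Matrix.unitaryGroup (Fin d) ℂ,
      ((U : Matrix (Fin d) (Fin d) ℂ) * Y * (U : Matrix (Fin d) (Fin d) ℂ)ᴴ) i j ∂μ with hM
  have hint := integrable_aux d μ Y
  -- the integral against a fixed matrix
  have hL : ∀ A : Matrix (Fin d) (Fin d) ℂ,
      ∫ U : Matrix.unitaryGroup (Fin d) ℂ,
        (A * (U : Matrix (Fin d) (Fin d) ℂ) * Y * (U : Matrix (Fin d) (Fin d) ℂ)ᴴ).trace ∂μ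
      = (A * M).trace := by
    intro A
    have : ∀ U : Matrix.unitaryGroup (Fin d) ℂ,
        (A * (U : Matrix (Fin d) (Fin d) ℂ) * Y * (U : Matrix (Fin d) (Fin d) ℂ)ᴴ).trace
        = ∑ i, ∑ j, A i j *
          ((U : Matrix (Fin d) (Fin d) ℂ) * Y * (U : Matrix (Fin d) (Fin d) ℂ)ᴴ) j i := by
      intro U
      rw [Matrix.mul_assoc, Matrix.mul_assoc, ← Matrix.mul_assoc (U : Matrix (Fin d) (Fin d) ℂ)]
      rfl
    simp_rw [this]
    refine (integral_finsetSum _ fun i _ => integrable_finsetSum _ fun j _ =>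
      (hint j i).const_mul (A i j)).trans ?_
    simp only [Matrix.trace, Matrix.diag, Matrix.mul_apply (M := A) (N := M)]
    refine Finset.sum_congr rfl fun i _ => ?_
    refine (integral_finsetSum _ fun j _ => (hint j i).const_mul (A i j)).trans ?_
    refine Finset.sum_congr rfl fun j _ => ?_
    rw [integral_const_mul]
    rfl
  have hinv : ∀ (V : Matrix.unitaryGroup (Fin d) ℂ) (A : Matrix (Fin d) (Fin d) ℂ),
      (A * ((V : Matrix (Fin d) (Fin d) ℂ) * M)).trace
        = (A * (M * (V : Matrix (Fin d) (Fin d) ℂ))).trace := by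
    intro V A
    have e : (A * (M * (V : Matrix (Fin d) (Fin d) ℂ))).trace
        = ((V : Matrix (Fin d) (Fin d) ℂ) * A * M).trace := by
      rw [← Matrix.mul_assoc, Matrix.trace_mul_comm, Matrix.mul_assoc]
    rw [e, ← Matrix.mul_assoc, ← hL, ← hL]
    rw [← integral_mul_left_eq_self (fun U : Matrix.unitaryGroup (Fin d) ℂ =>
      ((V : Matrix (Fin d) (Fin d) ℂ) * A * (U : Matrix (Fin d) (Fin d) ℂ) * Y *
        (U : Matrix (Fin d) (Fin d) ℂ)ᴴ).trace) V]
    refine integral_congr_ae (ae_of_all _ fun U => ?_)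
    have hV : (V : Matrix (Fin d) (Fin d) ℂ)ᴴ * (V : Matrix (Fin d) (Fin d) ℂ) = 1 :=
      Matrix.mem_unitaryGroup_iff'.mp V.2
    simp only [Matrix.UnitaryGroup.mul_val, Matrix.conjTranspose_mul]
    symm
    simp only [Matrix.mul_assoc]
    rw [Matrix.trace_mul_comm]
    simp only [Matrix.mul_assoc]
    rw [hV, Matrix.mul_one]
  have hcomm : ∀ A : Matrix (Fin d) (Fin d) ℂ, Commute A M := by
    intro A
    have hA : A ∈ Submodule.span ℂ
      (unitary (Matrix (Fin d) (Fin d) ℂ) : Set (Matrix (Fin d) (Fin d) ℂ)) := by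
      rw [span_u_aux]; trivial
    induction hA using Submodule.span_induction with
    | mem V hV => exact Matrix.ext_iff_trace_mul_left.mpr fun B => hinv ⟨V, hV⟩ B
    | zero => exact Commute.zero_left _
    | add x y _ _ hx hy => exact hx.add_left hy
    | smul a x _ hx => exact hx.smul_left a
  obtain ⟨c, hc⟩ := Matrix.mem_range_scalar_of_commute_single (M := M)
    fun i j _ => hcomm _
  have h1 := hL 1
  have h2 : ∀ U : Matrix.unitaryGroup (Fin d) ℂ,
      (1 * (U : Matrix (Fin d) (Fin d) ℂ) * Y * (U : Matrix (Fin d) (Fin d) ℂ)ᴴ).trace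
      = Y.trace := by
    intro U
    have hU : (U : Matrix (Fin d) (Fin d) ℂ)ᴴ * (U : Matrix (Fin d) (Fin d) ℂ) = 1 :=
      Matrix.mem_unitaryGroup_iff'.mp U.2
    rw [Matrix.one_mul, Matrix.trace_mul_comm, ← Matrix.mul_assoc, hU, Matrix.one_mul]
  simp_rw [h2] at h1
  have hd' : (d : ℂ) ≠ 0 := by exact_mod_cast hd.ne'
  rw [hL, ← hc]
  rw [← hc] at h1
  have h3 : Y.trace = d * c := by simpa using h1
  have h4 : (X * (Matrix.scalar (Fin d)) c).trace = X.trace * c := by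
    simp [Matrix.trace, Finset.sum_mul]
  rw [h4, h3]
  field_simp
end

section
/- Let d ≥ 2 be an integer, let X be a complex matrix indexed by pairs (i,j) with i, j ∈ {1,…,d}, and let F be the flip matrix defined by F_{(i,j),(k,l)} = 1 if i = l and j = k, and 0 otherwise. Then ∫_{U(d)} (U ⊗ U) X (U ⊗ U)* dμ(U) = (1/(d²−1)) · [ (Tr(X) − Tr(XF)/d) · I + (Tr(XF) − Tr(X)/d) · F ], where U ⊗ U denotes the Kronecker product of U with itself and I is the identity matrix of size d². -/
open MeasureTheory Matrix Kronecker

lemma tw_compact (d : ℕ) : CompactSpace (Matrix.unitaryGroup (Fin d) ℂ) := by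
  have hK : IsCompact {M : Matrix (Fin d) (Fin d) ℂ | ∀ i j, M i j ∈ Metric.closedBall (0:ℂ) 1} :=
    isCompact_pi_infinite fun i => isCompact_pi_infinite fun j => isCompact_closedBall (0:ℂ) 1
  have hc : IsClosed ((Matrix.unitaryGroup (Fin d) ℂ : Submonoid _) : Set (Matrix (Fin d) (Fin d) ℂ)) := by
    have : ((Matrix.unitaryGroup (Fin d) ℂ : Submonoid _) : Set (Matrix (Fin d) (Fin d) ℂ))
        = {M | M * star M = 1} := by
      ext M
      exact Matrix.mem_unitaryGroup_iff
    rw [this]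
    exact isClosed_eq (by fun_prop) continuous_const
  have := hK.of_isClosed_subset hc (fun M hM i j => by
    simpa using entry_norm_bound_of_unitary hM i j)
  exact isCompact_iff_compactSpace.mp this

def twD {d : ℕ} (A : Matrix (Fin d) (Fin d) ℂ) : Matrix (Fin d × Fin d) (Fin d × Fin d) ℂ :=
  A ⊗ₖ (1 : Matrix (Fin d) (Fin d) ℂ) + (1 : Matrix (Fin d) (Fin d) ℂ) ⊗ₖ A

lemma twD_add {d : ℕ} (A B : Matrix (Fin d) (Fin d) ℂ) : twD (A + B) = twD A + twD B := by
  simp only [twD, add_kronecker, kronecker_add]; abel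

lemma twD_smul {d : ℕ} (c : ℂ) (A : Matrix (Fin d) (Fin d) ℂ) : twD (c • A) = c • twD A := by
  simp only [twD, smul_kronecker, kronecker_smul, smul_add]

lemma tw_unit {d : ℕ} (P : Matrix (Fin d) (Fin d) ℂ) (hP : Pᴴ = P) (hPP : P * P = P) (w : ℂ)
    (hw : w + star w + w * star w = 0) : 1 + w • P ∈ Matrix.unitaryGroup (Fin d) ℂ := by
  rw [Matrix.mem_unitaryGroup_iff, star_eq_conjTranspose, conjTranspose_add, conjTranspose_smul, hP,
    conjTranspose_one, add_mul, mul_add, mul_add, smul_mul_smul_comm, hPP]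
  simp only [one_mul, mul_one]
  have : (w + star w + w * star w) • P = 0 := by rw [hw, zero_smul]
  rw [add_smul, add_smul] at this
  rw [add_assoc, show star w • P + (w • P + (w * star w) • P)
    = w • P + star w • P + (w * star w) • P by abel, this, add_zero]

lemma tw_proj {d : ℕ} (Y : Matrix (Fin d × Fin d) (Fin d × Fin d) ℂ)
    (hY : ∀ V ∈ Matrix.unitaryGroup (Fin d) ℂ, Commute (V ⊗ₖ V) Y)
    (P : Matrix (Fin d) (Fin d) ℂ) (hP : Pᴴ = P) (hPP : P * P = P) : Commute (twD P) Y := by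
  have h1 := hY _ (tw_unit P hP hPP (-2) (by norm_num))
  have h2 := hY _ (tw_unit P hP hPP (Complex.I - 1) (by
    simp only [star_sub, star_one, Complex.star_def, Complex.conj_I]
    ring_nf; simp))
  have h3 : twD P = (-(Complex.I / 2)) • ((1 + (-2 : ℂ) • P) ⊗ₖ (1 + (-2 : ℂ) • P))
      + (-1 : ℂ) • ((1 + (Complex.I - 1) • P) ⊗ₖ (1 + (Complex.I - 1) • P))
      + (Complex.I / 2 + 1) • (1 : Matrix (Fin d × Fin d) (Fin d × Fin d) ℂ) := by
    simp only [twD, add_kronecker, kronecker_add, smul_kronecker, kronecker_smul, one_kronecker_one]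
    have hI := Complex.I_sq
    ext a b
    simp only [Matrix.add_apply, Matrix.smul_apply, smul_eq_mul]
    linear_combination (P ⊗ₖ P) a b * hI
  rw [h3]
  exact ((h1.smul_left _).add_left (h2.smul_left _)).add_left ((Commute.one_left Y).smul_left _)

lemma tw_single {d : ℕ} (Y : Matrix (Fin d × Fin d) (Fin d × Fin d) ℂ)
    (hY : ∀ V ∈ Matrix.unitaryGroup (Fin d) ℂ, Commute (V ⊗ₖ V) Y)
    (p q : Fin d) : Commute (twD (single p q (1:ℂ))) Y := by
  have hd : ∀ p : Fin d, Commute (twD (single p p (1:ℂ))) Y := fun p =>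
    tw_proj Y hY _ (by simp) (by simp)
  by_cases hpq : p = q
  · subst hpq; exact hd p
  have hqp : q ≠ p := fun h => hpq h.symm
  have h1 := tw_proj Y hY ((1/2 : ℂ) • (single p p (1:ℂ) + single q q 1 + single p q 1 + single q p 1))
    (by simp [conjTranspose_smul, conjTranspose_add]; abel_nf)
    (by
      simp only [smul_mul_smul_comm, add_mul, mul_add, single_mul_single_same,
        single_mul_single_of_ne _ _ _ _ hpq, single_mul_single_of_ne _ _ _ _ hqp]
      ext i j
      simp only [Matrix.add_apply, Matrix.smul_apply, smul_eq_mul, mul_one, Matrix.zero_apply]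
      ring)
  have h2 := tw_proj Y hY ((1/2 : ℂ) • (single p p (1:ℂ) + single q q 1
      + (-Complex.I) • single p q 1 + Complex.I • single q p 1))
    (by
      simp only [conjTranspose_smul, conjTranspose_add, conjTranspose_single, star_one, star_neg,
        Complex.star_def, Complex.conj_I, map_div₀, map_one, map_ofNat]
      ext i j
      simp only [Matrix.add_apply, Matrix.smul_apply, smul_eq_mul]
      ring)
    (by
      simp only [smul_mul_smul_comm, add_mul, mul_add, single_mul_single_same, smul_mul_assoc,
        mul_smul_comm,
        single_mul_single_of_ne _ _ _ _ hpq, single_mul_single_of_ne _ _ _ _ hqp]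
      have hI := Complex.I_sq
      ext i j
      simp only [Matrix.add_apply, Matrix.smul_apply, smul_eq_mul, mul_one, Matrix.zero_apply]
      linear_combination (-1/4 : ℂ) * (single p p (1:ℂ) i j + single q q (1:ℂ) i j) * hI)
  have h3 : single p q (1:ℂ) =
      (1:ℂ) • ((1/2 : ℂ) • (single p p (1:ℂ) + single q q 1 + single p q 1 + single q p 1))
      + Complex.I • ((1/2 : ℂ) • (single p p (1:ℂ) + single q q 1
      + (-Complex.I) • single p q 1 + Complex.I • single q p 1))
      + (-(1 + Complex.I)/2) • (single p p (1:ℂ) + single q q 1) := by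
    have hI := Complex.I_sq
    ext i j
    simp only [Matrix.add_apply, Matrix.smul_apply, smul_eq_mul]
    linear_combination (1/2 : ℂ) * (single p q (1:ℂ) i j - single q p (1:ℂ) i j) * hI
  rw [h3, twD_add, twD_add, twD_smul 1, twD_smul Complex.I,
    twD_smul (-(1 + Complex.I) / 2), twD_add (single p p 1) (single q q 1)]
  exact ((h1.smul_left _).add_left (h2.smul_left _)).add_left (((hd p).add_left (hd q)).smul_left _)

lemma tw_entry {d : ℕ} (Y : Matrix (Fin d × Fin d) (Fin d × Fin d) ℂ)
    (p q : Fin d) (h : Commute (twD (single p q (1:ℂ))) Y) (i j k l : Fin d) :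
    (if i = p then Y (q, j) (k, l) else 0) + (if j = p then Y (i, q) (k, l) else 0) =
    (if k = q then Y (i, j) (p, l) else 0) + (if l = q then Y (i, j) (k, p) else 0) := by
  have := congrFun (congrFun h.eq (i, j)) (k, l)
  simp only [twD, add_mul, mul_add, Matrix.add_apply, Matrix.mul_apply, Fintype.sum_prod_type,
    kronecker_apply, single_apply, one_apply, ite_and, mul_ite, ite_mul, mul_one, one_mul, mul_zero,
    zero_mul, Finset.sum_ite_eq, Finset.sum_ite_eq', Finset.mem_univ, if_true, Finset.sum_const_zero, Finset.sum_add_distrib] at this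
  simpa [eq_comm, Finset.sum_ite_eq, Finset.sum_ite_eq', Finset.sum_add_distrib] using this

lemma tw_commutant {d : ℕ} (hd : 2 ≤ d) (Y : Matrix (Fin d × Fin d) (Fin d × Fin d) ℂ)
    (hY : ∀ V ∈ Matrix.unitaryGroup (Fin d) ℂ, Commute (V ⊗ₖ V) Y) :
    ∃ α β : ℂ, ∀ i j k l, Y (i, j) (k, l) =
      α * (if i = k ∧ j = l then 1 else 0) + β * (if i = l ∧ j = k then 1 else 0) := by
  have E := fun p q i j k l => tw_entry Y p q (tw_single Y hY p q) i j k l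
  clear hY
  -- symmetric b
  have ha1 : ∀ p q, p ≠ q → Y (p, p) (p, p) = Y (q, p) (p, q) + Y (p, q) (p, q) := by
    intro p q h
    have := E p q p p p q
    simp [h] at this
    exact this.symm
  have ha2 : ∀ p q, p ≠ q → Y (q, q) (q, q) = Y (p, q) (p, q) + Y (p, q) (q, p) := by
    intro p q h
    have := E p q p q q q
    simp [h, h.symm] at this
    exact this
  have ha3 : ∀ p q, p ≠ q → Y (p, p) (p, p) = Y (q, p) (q, p) + Y (p, q) (q, p) := by
    intro p q h
    have := E p q p p q p
    simp [h] at this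
    exact this.symm
  have hb1 : ∀ p q r, r ≠ p → r ≠ q → Y (p, r) (p, r) = Y (q, r) (q, r) := by
    intro p q r h1 h2
    have := E p q p r q r
    simp [h1, h2] at this
    exact this.symm
  have hbs : ∀ p q, p ≠ q → Y (p, q) (p, q) = Y (q, p) (q, p) := by
    intro p q h
    linear_combination ha1 q p h.symm - ha2 p q h
  have ha : ∀ p q, p ≠ q → Y (p, p) (p, p) = Y (q, q) (q, q) := by
    intro p q h
    linear_combination ha3 p q h - ha1 q p h.symm
  let u : Fin d := ⟨0, by omega⟩
  let v : Fin d := ⟨1, by omega⟩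
  have huv : u ≠ v := by simp [u, v]
  have hb : ∀ p q, p ≠ q → Y (p, q) (p, q) = Y (u, v) (u, v) := by
    intro p q h
    by_cases hq : q = u
    · subst hq
      rw [hbs _ _ h, hbs u v huv]
      rw [hbs u p h.symm]
      exact hb1 _ _ _ h.symm huv
    · rw [hb1 p u q h.symm hq, hbs u q (Ne.symm hq), hbs u v huv]
      exact hb1 _ _ _ (Ne.symm hq) huv
  have haa : ∀ p, Y (p, p) (p, p) = Y (u, u) (u, u) := by
    intro p
    by_cases h : p = u
    · rw [h]
    · exact ha _ _ h
  refine ⟨Y (u, v) (u, v), Y (u, u) (u, u) - Y (u, v) (u, v), ?_⟩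
  intro i j k l
  by_cases h1 : i = k ∧ j = l
  · obtain ⟨rfl, rfl⟩ := h1
    by_cases hij : i = j
    · subst hij
      simp [haa i]
    · simp [hij, hb i j hij]
  · by_cases h2 : i = l ∧ j = k
    · obtain ⟨rfl, rfl⟩ := h2
      have hij : i ≠ j := fun h => h1 ⟨h, h.symm⟩
      simp only [hij, hij.symm, false_and, if_false, true_and, and_self, if_true]
      have := ha1 j i hij.symm
      rw [haa j, hb j i hij.symm] at this
      linear_combination -this
    · simp only [h1, h2, if_false]
      have e1 := E i i i j k l
      have e2 := E j j i j k l
      simp only [if_true] at e1 e2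
      clear E ha1 ha2 ha3 hb1 hbs ha hb haa
      by_cases a1 : i = j <;> by_cases a2 : k = i <;> by_cases a3 : l = i <;>
        by_cases a4 : k = j <;> by_cases a5 : l = j <;> simp_all

/-- Bipartite twirling: for `U` Haar-random in `U(d)` and `F` the flip operator,
`∫ (U ⊗ U) X (U ⊗ U)* dμ(U) = (1/(d²−1)) [ (Tr X − Tr(XF)/d) I + (Tr(XF) − Tr X/d) F ]`,
the integral being taken entrywise. -/
theorem stmt_10 (d : ℕ) (hd : 2 ≤ d)
    (μ : Measure (Matrix.unitaryGroup (Fin d) ℂ))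
    [μ.IsHaarMeasure] [IsProbabilityMeasure μ]
    (X : Matrix (Fin d × Fin d) (Fin d × Fin d) ℂ)
    (F : Matrix (Fin d × Fin d) (Fin d × Fin d) ℂ)
    (hF : ∀ i j l m : Fin d, F (i, j) (l, m) = if i = m ∧ j = l then 1 else 0)
    (a b : Fin d × Fin d) :
    ∫ U : Matrix.unitaryGroup (Fin d) ℂ,
        (((U : Matrix (Fin d) (Fin d) ℂ) ⊗ₖ (U : Matrix (Fin d) (Fin d) ℂ)) * X *
            ((U : Matrix (Fin d) (Fin d) ℂ) ⊗ₖ (U : Matrix (Fin d) (Fin d) ℂ))ᴴ) a b ∂μ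
      = (1 / ((d : ℂ)^2 - 1)) *
          ((X.trace - (X * F).trace / (d : ℂ)) *
              (1 : Matrix (Fin d × Fin d) (Fin d × Fin d) ℂ) a b +
            ((X * F).trace - X.trace / (d : ℂ)) * F a b) := by
  haveI := tw_compact d
  let T : Matrix.unitaryGroup (Fin d) ℂ → Matrix (Fin d × Fin d) (Fin d × Fin d) ℂ := fun U =>
    ((U : Matrix (Fin d) (Fin d) ℂ) ⊗ₖ (U : Matrix (Fin d) (Fin d) ℂ)) * X *
            ((U : Matrix (Fin d) (Fin d) ℂ) ⊗ₖ (U : Matrix (Fin d) (Fin d) ℂ))ᴴ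
  have hTc : Continuous T := by
    have hk : Continuous fun U : Matrix.unitaryGroup (Fin d) ℂ =>
        ((U : Matrix (Fin d) (Fin d) ℂ) ⊗ₖ (U : Matrix (Fin d) (Fin d) ℂ)) := by
      refine continuous_matrix fun a b => ?_
      simp only [kroneckerMap_apply]
      exact (continuous_subtype_val.matrix_elem _ _).mul (continuous_subtype_val.matrix_elem _ _)
    exact (hk.matrix_mul continuous_const).matrix_mul hk.matrix_conjTranspose
  have hTi : ∀ a b, Integrable (fun U => T U a b) μ := fun a b =>
    (hTc.matrix_elem a b).integrable_of_hasCompactSupport (HasCompactSupport.of_compactSpace _)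
  let Y : Matrix (Fin d × Fin d) (Fin d × Fin d) ℂ := Matrix.of fun a b => ∫ U, T U a b ∂μ
  have hlin : ∀ A B : Matrix (Fin d × Fin d) (Fin d × Fin d) ℂ, ∀ a b,
      (A * Y * B) a b = ∫ U, (A * T U * B) a b ∂μ := by
    intro A B a b
    simp only [Matrix.mul_apply]
    rw [integral_finset_sum]
    · refine Finset.sum_congr rfl fun c _ => ?_
      rw [integral_mul_const, integral_finset_sum]
      · simp only [integral_const_mul]; rfl
      · exact fun e _ => (hTi _ _).const_mul _
    · exact fun c _ => (integrable_finset_sum _ fun e _ => (hTi _ _).const_mul _).mul_const _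
  have htr : ∀ B : Matrix (Fin d × Fin d) (Fin d × Fin d) ℂ,
      (Y * B).trace = ∫ U, (T U * B).trace ∂μ := by
    intro B
    simp only [Matrix.trace, Matrix.diag]
    rw [integral_finset_sum]
    · refine Finset.sum_congr rfl fun c _ => ?_
      have := hlin 1 B c c
      simpa only [one_mul] using this
    · intro c _
      simp only [Matrix.mul_apply]
      exact integrable_finset_sum _ fun e _ => (hTi _ _).mul_const _
  have hUU : ∀ U ∈ Matrix.unitaryGroup (Fin d) ℂ, (U ⊗ₖ U)ᴴ * (U ⊗ₖ U) = 1 := by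
    intro U hU
    rw [conjTranspose_kronecker, ← mul_kronecker_mul, ← star_eq_conjTranspose,
      Matrix.mem_unitaryGroup_iff'.mp hU, one_kronecker_one]
  have hinv : ∀ V ∈ Matrix.unitaryGroup (Fin d) ℂ, Commute (V ⊗ₖ V) Y := by
    intro V hV
    have h1 : (V ⊗ₖ V) * Y * (V ⊗ₖ V)ᴴ = Y := by
      ext a b
      rw [hlin]
      have := integral_mul_left_eq_self (μ := μ) (fun U => T U a b) ⟨V, hV⟩
      refine Eq.trans ?_ this
      congr 1
      ext U
      simp only [T, Submonoid.coe_mul, mul_kronecker_mul, conjTranspose_mul, Matrix.mul_assoc]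
    have h2 : (V ⊗ₖ V) * Y * (V ⊗ₖ V)ᴴ * (V ⊗ₖ V) = Y * (V ⊗ₖ V) := by rw [h1]
    rw [Matrix.mul_assoc, hUU V hV, Matrix.mul_one] at h2
    exact h2
  have hF' : ∀ a b, F a b = if b = a.swap then 1 else 0 := by
    rintro ⟨i, j⟩ ⟨k, l⟩
    rw [hF]
    simp only [Prod.swap_prod_mk, Prod.mk.injEq]
    congr 1
    apply propext
    constructor
    · rintro ⟨rfl, rfl⟩; exact ⟨rfl, rfl⟩
    · rintro ⟨rfl, rfl⟩; exact ⟨rfl, rfl⟩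
  have hF'' : ∀ a b, F a b = if a = b.swap then 1 else 0 := by
    intro a b
    rw [hF']
    congr 1
    apply propext
    constructor
    · rintro rfl; simp
    · rintro rfl; simp
  have hFM : ∀ M : Matrix (Fin d × Fin d) (Fin d × Fin d) ℂ, ∀ a b, (M * F) a b = M a b.swap := by
    intro M a b
    simp [Matrix.mul_apply, hF'']
  have hFL : ∀ M : Matrix (Fin d × Fin d) (Fin d × Fin d) ℂ, ∀ a b, (F * M) a b = M a.swap b := by
    intro M a b
    simp [Matrix.mul_apply, hF']
  have hFc : ∀ U : Matrix (Fin d) (Fin d) ℂ, (U ⊗ₖ U) * F = F * (U ⊗ₖ U) := by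
    intro U
    ext a b
    rw [hFM, hFL]
    simp [kroneckerMap_apply, mul_comm]
  have ht1 : Y.trace = X.trace := by
    have := htr 1
    simp only [Matrix.mul_one] at this
    rw [this]
    have h : ∀ U, (T U).trace = X.trace := by
      intro U
      simp only [T]
      rw [Matrix.trace_mul_comm, ← Matrix.mul_assoc, hUU U.1 U.2, Matrix.one_mul]
    simp [h]
  have ht2 : (Y * F).trace = (X * F).trace := by
    rw [htr F]
    have h : ∀ U, (T U * F).trace = (X * F).trace := by
      intro U
      have e : ((U : Matrix (Fin d) (Fin d) ℂ) ⊗ₖ (U : Matrix (Fin d) (Fin d) ℂ))ᴴ * F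
          = F * ((U : Matrix (Fin d) (Fin d) ℂ) ⊗ₖ (U : Matrix (Fin d) (Fin d) ℂ))ᴴ := by
        rw [conjTranspose_kronecker, hFc]
      simp only [T]
      rw [Matrix.mul_assoc, e, ← Matrix.mul_assoc, Matrix.trace_mul_comm, Matrix.mul_assoc,
        ← Matrix.mul_assoc, ← Matrix.mul_assoc, hUU U.1 U.2, Matrix.one_mul]
    simp [h]
  obtain ⟨α, β, hαβ⟩ := tw_commutant hd Y hinv
  have hY : Y = α • (1 : Matrix (Fin d × Fin d) (Fin d × Fin d) ℂ) + β • F := by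
    ext ⟨i, j⟩ ⟨k, l⟩
    rw [hαβ]
    simp [hF, Matrix.one_apply]
  have hFF : F * F = 1 := by
    ext a b
    rw [hFM, hF', Matrix.one_apply]
    simp [eq_comm]
  have htrF : F.trace = d := by
    simp [Matrix.trace, Fintype.sum_prod_type, hF, ite_and]
  have htrI : (1 : Matrix (Fin d × Fin d) (Fin d × Fin d) ℂ).trace = (d:ℂ)^2 := by
    simp [Matrix.trace_one, sq]
  have q1 : X.trace = α * (d:ℂ)^2 + β * d := by
    rw [← ht1, hY, Matrix.trace_add, Matrix.trace_smul, Matrix.trace_smul, htrF, htrI]; rfl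
  have q2 : (X * F).trace = α * d + β * (d:ℂ)^2 := by
    rw [← ht2, hY, Matrix.add_mul, Matrix.smul_mul, Matrix.smul_mul, hFF, Matrix.one_mul,
      Matrix.trace_add, Matrix.trace_smul, Matrix.trace_smul, htrF, htrI]; rfl
  have hd0 : (d:ℂ) ≠ 0 := by
    have : d ≠ 0 := by omega
    exact_mod_cast this
  have hd1 : (d:ℂ)^2 - 1 ≠ 0 := by
    rw [sub_ne_zero]
    have : d^2 ≠ 1 := by nlinarith
    exact_mod_cast this
  change Y a b = _
  rw [q1, q2, hY]
  simp only [Matrix.add_apply, Matrix.smul_apply, smul_eq_mul]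
  generalize (1 : Matrix (Fin d × Fin d) (Fin d × Fin d) ℂ) a b = x
  generalize F a b = y
  field_simp
  ring
end

section
/- Let n, k, d be positive integers with nk ≥ 2 and let ι : {1,…,d} → {1,…,n} × {1,…,k} be an injective map. For U ∈ U(nk), viewed as a unitary matrix indexed by pairs (i,j) with i ∈ {1,…,n}, j ∈ {1,…,k}, define the isometry columns V_{(i,j),a} = U_{(i,j),ι(a)} for a ∈ {1,…,d}, and define the overlap f(U) = (1/(dk)) Σ_{a,b=1}^{d} Σ_{j,j'=1}^{k} | Σ_{i=1}^{n} V_{(i,j),a} · conj(V_{(i,j'),b}) |². Then ∫_{U(nk)} f(U) dμ(U) = ( d·n·(k²−1) + k·(n²−1) ) / ( k·(k²n²−1) ). -/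
open MeasureTheory Matrix

namespace HaarAux

variable {I : Type*} [Fintype I] [DecidableEq I]

/-- fourth moment -/
noncomputable def M (μ : Measure (Matrix.unitaryGroup I ℂ)) (a b p s r q : I) : ℂ :=
  ∫ U : Matrix.unitaryGroup I ℂ, (U : Matrix I I ℂ) p a * (U : Matrix I I ℂ) s b *
    star ((U : Matrix I I ℂ) r a) * star ((U : Matrix I I ℂ) q b) ∂μ

lemma integrable_M (μ : Measure (Matrix.unitaryGroup I ℂ)) [IsProbabilityMeasure μ]
    (a b p s r q : I) :
    Integrable (fun U : Matrix.unitaryGroup I ℂ => (U : Matrix I I ℂ) p a * (U : Matrix I I ℂ) s b *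
    star ((U : Matrix I I ℂ) r a) * star ((U : Matrix I I ℂ) q b)) μ := by
  have hc : ∀ x y : I, Continuous (fun U : Matrix.unitaryGroup I ℂ => (U : Matrix I I ℂ) x y) := by
    intro x y
    exact (continuous_subtype_val).matrix_elem x y
  refine Integrable.of_bound (C := 1) ?_ ?_
  · refine Continuous.aestronglyMeasurable ?_
    exact (((hc p a).mul (hc s b)).mul (hc r a).star).mul (hc q b).star
  · refine Filter.Eventually.of_forall fun U => ?_
    have h := fun x y => entry_norm_bound_of_unitary U.2 x y
    simp only [norm_mul, norm_star]
    have h0 := fun x y => norm_nonneg ((U : Matrix I I ℂ) x y)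
    have h1 := mul_le_one₀ (h p a) (h0 s b) (h s b)
    have h2 := mul_le_one₀ h1 (h0 r a) (h r a)
    exact mul_le_one₀ h2 (h0 q b) (h q b)

lemma prod4 (f g h l : I → ℂ) : (∑ x, f x) * (∑ x, g x) * (∑ x, h x) * (∑ x, l x) =
    ∑ x, ∑ y, ∑ z, ∑ w, f x * g y * h z * l w := by
  simp only [mul_assoc, ← Finset.mul_sum, ← Finset.sum_mul]

lemma M_inv (μ : Measure (Matrix.unitaryGroup I ℂ)) [IsProbabilityMeasure μ] [μ.IsHaarMeasure]
    (a b p s r q : I) (g : Matrix.unitaryGroup I ℂ) :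
    M μ a b p s r q = ∑ p', ∑ s', ∑ r', ∑ q', (g : Matrix I I ℂ) p p' * (g : Matrix I I ℂ) s s' *
      star ((g : Matrix I I ℂ) r r') * star ((g : Matrix I I ℂ) q q') * M μ a b p' s' r' q' := by
  have h := integral_mul_left_eq_self (μ := μ) (fun U : Matrix.unitaryGroup I ℂ =>
    (U : Matrix I I ℂ) p a * (U : Matrix I I ℂ) s b *
    star ((U : Matrix I I ℂ) r a) * star ((U : Matrix I I ℂ) q b)) g
  rw [M, ← h]
  have e : ∀ U : Matrix.unitaryGroup I ℂ, ((g * U : Matrix.unitaryGroup I ℂ) : Matrix I I ℂ) p a * ((g * U : Matrix.unitaryGroup I ℂ) : Matrix I I ℂ) s b *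
    star (((g * U : Matrix.unitaryGroup I ℂ) : Matrix I I ℂ) r a) * star (((g * U : Matrix.unitaryGroup I ℂ) : Matrix I I ℂ) q b)
    = ∑ p', ∑ s', ∑ r', ∑ q', ((g : Matrix I I ℂ) p p' * (g : Matrix I I ℂ) s s' *
      star ((g : Matrix I I ℂ) r r') * star ((g : Matrix I I ℂ) q q')) * ((U : Matrix I I ℂ) p' a * (U : Matrix I I ℂ) s' b *
    star ((U : Matrix I I ℂ) r' a) * star ((U : Matrix I I ℂ) q' b)) := by
    intro U
    simp only [Matrix.UnitaryGroup.mul_val, Matrix.mul_apply, star_sum, star_mul']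
    rw [prod4]
    refine Finset.sum_congr rfl fun p' _ => Finset.sum_congr rfl fun s' _ =>
      Finset.sum_congr rfl fun r' _ => Finset.sum_congr rfl fun q' _ => ?_
    ring
  simp only [e]
  have hi := fun p' s' r' q' => integrable_M μ a b p' s' r' q'
  have h1 : ∀ p' s' r' q', Integrable (fun U : Matrix.unitaryGroup I ℂ => ((g : Matrix I I ℂ) p p' * (g : Matrix I I ℂ) s s' *
      star ((g : Matrix I I ℂ) r r') * star ((g : Matrix I I ℂ) q q')) * ((U : Matrix I I ℂ) p' a * (U : Matrix I I ℂ) s' b *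
    star ((U : Matrix I I ℂ) r' a) * star ((U : Matrix I I ℂ) q' b))) μ := fun p' s' r' q' =>
      (hi p' s' r' q').const_mul _
  rw [integral_finsetSum _ fun p' _ => integrable_finsetSum _ fun s' _ => integrable_finsetSum _ fun r' _ =>
    integrable_finsetSum _ fun q' _ => h1 p' s' r' q']
  refine Finset.sum_congr rfl fun p' _ => ?_
  rw [integral_finsetSum _ fun s' _ => integrable_finsetSum _ fun r' _ =>
    integrable_finsetSum _ fun q' _ => h1 p' s' r' q']
  refine Finset.sum_congr rfl fun s' _ => ?_
  rw [integral_finsetSum _ fun r' _ =>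
    integrable_finsetSum _ fun q' _ => h1 p' s' r' q']
  refine Finset.sum_congr rfl fun r' _ => ?_
  rw [integral_finsetSum _ fun q' _ => h1 p' s' r' q']
  refine Finset.sum_congr rfl fun q' _ => ?_
  rw [integral_const_mul, M]

/-- invariance under the conjugation action of the unitary group -/
def Inv (T : I → I → I → I → ℂ) : Prop := ∀ (g : Matrix.unitaryGroup I ℂ) (p s r q : I),
    T p s r q = ∑ p', ∑ s', ∑ r', ∑ q', (g : Matrix I I ℂ) p p' * (g : Matrix I I ℂ) s s' *
      star ((g : Matrix I I ℂ) r r') * star ((g : Matrix I I ℂ) q q') * T p' s' r' q'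

lemma Inv.phase {T : I → I → I → I → ℂ} (h : Inv T) (t p s r q : I) :
    T p s r q = (if p = t then Complex.I else 1) * (if s = t then Complex.I else 1) *
      (if r = t then -Complex.I else 1) * (if q = t then -Complex.I else 1) * T p s r q := by
  have hg : Matrix.diagonal (fun i => if i = t then Complex.I else (1:ℂ)) ∈ Matrix.unitaryGroup I ℂ := by
    rw [Matrix.mem_unitaryGroup_iff, Matrix.star_eq_conjTranspose, Matrix.diagonal_conjTranspose,
      Matrix.diagonal_mul_diagonal, ← Matrix.diagonal_one]
    congr 1
    ext i
    by_cases hi : i = t <;> simp [hi]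
  have := h ⟨_, hg⟩ p s r q
  have e1 : ∀ (z : I → ℂ) (p : I) (f : I → ℂ), ∑ x, Matrix.diagonal z p x * f x = z p * f p := by
    intro z p f; simp [Matrix.diagonal_apply]
  have e2 : ∀ (z : I → ℂ) (p : I) (f : I → ℂ), ∑ x, star (Matrix.diagonal z p x) * f x = star (z p) * f p := by
    intro z p f; simp [Matrix.diagonal_apply, apply_ite (starRingEnd ℂ)]
  have e3 : ∀ x : I, star (if x = t then Complex.I else (1:ℂ)) = if x = t then -Complex.I else 1 := by
    intro x; split_ifs <;> simp
  simp only [mul_assoc, ← Finset.mul_sum, e1, e2, e3] at this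
  simp only [mul_assoc]
  exact this

lemma Inv.zero {T : I → I → I → I → ℂ} (h : Inv T) (p s r q : I) (h1 : ¬ (p = r ∧ s = q))
    (h2 : ¬ (p = q ∧ s = r)) : T p s r q = 0 := by
  have key : ∀ (z w : ℂ), z ≠ 1 → w = z * w → w = 0 := by
    intro z w hz hw
    have : (z - 1) * w = 0 := by linear_combination -hw
    rcases mul_eq_zero.1 this with h | h
    · exact absurd (by linear_combination h) hz
    · exact h
  have hI1 : Complex.I ≠ 1 := by simp [Complex.ext_iff]
  have hI2 : Complex.I * Complex.I ≠ 1 := by norm_num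
  by_cases hp : p ≠ r ∧ p ≠ q
  · refine key _ _ ?_ (h.phase p p s r q)
    rw [if_neg hp.1.symm, if_neg hp.2.symm]
    by_cases hs : s = p <;> simp [hs] <;> first | exact hI1 | norm_num
  · refine key _ _ ?_ (h.phase s p s r q)
    by_cases a1 : p = s <;> by_cases a2 : r = s <;> by_cases a3 : q = s <;>
      simp [a1, a2, a3] <;> first | exact hI1 | (exfalso; grind) | norm_num

lemma Inv.perm {T : I → I → I → I → ℂ} (h : Inv T) (σ : Equiv.Perm I) (p s r q : I) :
    T p s r q = T (σ p) (σ s) (σ r) (σ q) := by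
  have hg : (Matrix.of fun i j => if σ i = j then (1:ℂ) else 0) ∈ Matrix.unitaryGroup I ℂ := by
    rw [Matrix.mem_unitaryGroup_iff]
    ext i j
    simp [Matrix.mul_apply, Matrix.one_apply, Matrix.star_apply, apply_ite, eq_comm]
  have := h ⟨_, hg⟩ p s r q
  simpa [apply_ite star, Finset.sum_ite_eq] using this

lemma exists_perm {p s p0 s0 : I} (h : p ≠ s) (h0 : p0 ≠ s0) :
    ∃ σ : Equiv.Perm I, σ p0 = p ∧ σ s0 = s := by
  refine ⟨Equiv.swap (Equiv.swap p0 p s0) s * Equiv.swap p0 p, ?_, ?_⟩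
  · rw [Equiv.Perm.mul_apply, Equiv.swap_apply_left]
    apply Equiv.swap_apply_of_ne_of_ne _ h
    intro e
    have : Equiv.swap p0 p p0 = Equiv.swap p0 p s0 := by rw [← e, Equiv.swap_apply_left]
    exact h0 ((Equiv.swap p0 p).injective this)
  · simp

lemma Inv.hadamard {T : I → I → I → I → ℂ} (h : Inv T) {p s : I} (hps : p ≠ s) :
    T p p p p = T p s p s + T p s s p := by
  obtain ⟨c, hc, hcr⟩ : ∃ c : ℂ, c * c = 1 / 2 ∧ star c = c := by
    refine ⟨((√2)⁻¹ : ℝ), ?_, ?_⟩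
    · rw [← Complex.ofReal_mul, ← mul_inv, Real.mul_self_sqrt (by norm_num)]; norm_num
    · simp
  let g : Matrix I I ℂ := Matrix.of fun i j =>
    if i = p then (if j = p then c else 0) + (if j = s then c else 0)
    else if i = s then (if j = p then c else 0) + (if j = s then -c else 0)
    else if j = i then 1 else 0
  have hg : g ∈ Matrix.unitaryGroup I ℂ := by
    rw [Matrix.mem_unitaryGroup_iff]
    ext i j
    have hsp := hps.symm
    have hcr' : (starRingEnd ℂ) c = c := hcr
    by_cases i1 : i = p <;> by_cases i2 : i = s <;> by_cases j1 : j = p <;> by_cases j2 : j = s <;>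
      simp [g, Matrix.mul_apply, Matrix.one_apply, Matrix.star_apply, i1, i2, j1, j2, apply_ite star, add_mul, mul_add, Finset.sum_add_distrib, hps, hsp] <;> first | (rw [hcr', hc]; norm_num) | grind
  have := h ⟨g, hg⟩ p p p p
  have e : ∀ x, (g p x) = (if x = p then c else 0) + (if x = s then c else 0) := by
    intro x; simp [g]
  have e' : ∀ x, star (g p x) = (if x = p then c else 0) + (if x = s then c else 0) := by
    intro x; rw [e, star_add, apply_ite star, apply_ite star, star_zero, hcr]
  simp only [e'] at this
  simp only [e] at this
  have e2 : ∀ f : I → ℂ, ∑ x, ((if x = p then c else 0) + (if x = s then c else 0)) * f x = c * f p + c * f s := by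
    intro f; simp [add_mul, Finset.sum_add_distrib]
  simp only [mul_assoc, ← Finset.mul_sum, e2] at this
  have z := fun a b c d => h.zero a b c d
  have hsp := hps.symm
  obtain ⟨σ, h1, h2⟩ := exists_perm hps hsp
  have r1 := h.perm σ s s s s
  have r2 := h.perm σ s p s p
  have r3 := h.perm σ s p p s
  rw [h1, h2] at r2 r3
  rw [h1] at r1
  rw [r1, r2, r3, z p p p s (by grind) (by grind), z p p s p (by grind) (by grind),
    z p s p p (by grind) (by grind), z s p p p (by grind) (by grind),
    z s s s p (by grind) (by grind), z s s p s (by grind) (by grind),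
    z s p s s (by grind) (by grind), z p s s s (by grind) (by grind),
    z p p s s (by grind) (by grind), z s s p p (by grind) (by grind)] at this
  have hc4 : c * (c * (c * c)) = 1/4 := by rw [hc, ← mul_assoc, hc]; norm_num
  linear_combination 2 * this + (4 * (T p p p p + T p s p s + T p s s p)) * hc4

lemma Inv.eq {T : I → I → I → I → ℂ} (h : Inv T) (hN : 2 ≤ Fintype.card I) (δ : ℂ)
    (t1 : ∑ p, ∑ s, T p s p s = 1) (t2 : ∑ p, ∑ s, T p s s p = δ) (p s r q : I) :
    T p s r q = (if p = r ∧ s = q then ((Fintype.card I : ℂ) - δ) /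
        (Fintype.card I * ((Fintype.card I : ℂ)^2 - 1)) else 0)
      + (if p = q ∧ s = r then (Fintype.card I * δ - 1) /
        (Fintype.card I * ((Fintype.card I : ℂ)^2 - 1)) else 0) := by
  obtain ⟨p0, s0, h0⟩ := Fintype.one_lt_card_iff.1 (show 1 < Fintype.card I from hN)
  set A := T p0 s0 p0 s0 with hA
  set B := T p0 s0 s0 p0 with hB
  have had := h.hadamard h0
  have val : ∀ p s r q, T p s r q = (if p = r ∧ s = q then A else 0) + (if p = q ∧ s = r then B else 0) := by
    intro p s r q
    by_cases h1 : p = r ∧ s = q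
    · obtain ⟨rfl, rfl⟩ := h1
      by_cases hps : p = s
      · subst hps
        have := h.perm (Equiv.swap p0 p) p0 p0 p0 p0
        rw [Equiv.swap_apply_left] at this
        simp [← this, had, hA, hB]
      · obtain ⟨σ, h1, h2⟩ := exists_perm hps h0
        have := h.perm σ p0 s0 p0 s0
        rw [h1, h2] at this
        simp [hps, ← this, hA]
    · by_cases h2 : p = q ∧ s = r
      · obtain ⟨rfl, rfl⟩ := h2
        have hps : p ≠ s := by grind
        obtain ⟨σ, h1, h2⟩ := exists_perm hps h0
        have := h.perm σ p0 s0 s0 p0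
        rw [h1, h2] at this
        simp [hps, ← this, hB]
      · simp [h1, h2, h.zero p s r q h1 h2]
  have f1 : (Fintype.card I : ℂ)^2 * A + Fintype.card I * B = 1 := by
    rw [← t1]
    simp only [val]
    simp [Finset.sum_add_distrib, and_comm, ite_and]
    have : ∀ x y : I, (if x = y then if y = x then B else 0 else 0) = if x = y then B else 0 := by
      intro x y; split_ifs <;> grind
    try simp [this]
    try ring
  have f2 : (Fintype.card I : ℂ) * A + (Fintype.card I)^2 * B = δ := by
    rw [← t2]
    simp only [val]
    simp [Finset.sum_add_distrib, and_comm, ite_and]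
    have : ∀ x y : I, (if x = y then if y = x then A else 0 else 0) = if x = y then A else 0 := by
      intro x y; split_ifs <;> grind
    try simp [this]
    try ring
  have n0 : (Fintype.card I : ℂ) ≠ 0 := by
    have : Fintype.card I ≠ 0 := by omega
    exact_mod_cast this
  have n1 : (Fintype.card I : ℂ)^2 - 1 ≠ 0 := by
    have : (Fintype.card I)^2 ≠ 1 := by nlinarith
    intro hh
    apply this
    have : (Fintype.card I : ℂ)^2 = 1 := by linear_combination hh
    exact_mod_cast this
  have eA : A = ((Fintype.card I : ℂ) - δ) / (Fintype.card I * ((Fintype.card I : ℂ)^2 - 1)) := by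
    rw [eq_div_iff (mul_ne_zero n0 n1)]
    linear_combination (Fintype.card I : ℂ) * f1 - f2
  have eB : B = (Fintype.card I * δ - 1) / (Fintype.card I * ((Fintype.card I : ℂ)^2 - 1)) := by
    rw [eq_div_iff (mul_ne_zero n0 n1)]
    linear_combination (Fintype.card I : ℂ) * f2 - f1
  rw [val, ← eA, ← eB]

lemma M_eq (μ : Measure (Matrix.unitaryGroup I ℂ)) [IsProbabilityMeasure μ] [μ.IsHaarMeasure]
    (hN : 2 ≤ Fintype.card I) (a b p s r q : I) :
    M μ a b p s r q = (if p = r ∧ s = q then ((Fintype.card I : ℂ) - (if a = b then 1 else 0)) /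
        (Fintype.card I * ((Fintype.card I : ℂ)^2 - 1)) else 0)
      + (if p = q ∧ s = r then (Fintype.card I * (if a = b then 1 else 0) - 1) /
        (Fintype.card I * ((Fintype.card I : ℂ)^2 - 1)) else 0) := by
  have orth : ∀ (U : Matrix.unitaryGroup I ℂ) (x y : I), ∑ p, star ((U : Matrix I I ℂ) p x) * (U : Matrix I I ℂ) p y
      = if x = y then 1 else 0 := by
    intro U x y
    have := congrFun (congrFun (Matrix.mem_unitaryGroup_iff'.1 U.2) x) y
    simpa [Matrix.mul_apply, Matrix.one_apply, Matrix.star_apply] using this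
  refine Inv.eq (T := M μ a b) (fun g p s r q => M_inv μ a b p s r q g) hN _ ?_ ?_ p s r q
  · simp only [M]
    simp_rw [← integral_finsetSum _ fun s _ => integrable_M μ a b _ s _ s]
    rw [← integral_finsetSum _ fun p _ => integrable_finsetSum _ fun s _ => integrable_M μ a b p s p s]
    have : ∀ U : Matrix.unitaryGroup I ℂ, ∑ p, ∑ s, (U : Matrix I I ℂ) p a * (U : Matrix I I ℂ) s b *
    star ((U : Matrix I I ℂ) p a) * star ((U : Matrix I I ℂ) s b) = 1 := by
      intro U
      have h1 := orth U a a
      have h2 := orth U b b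
      rw [if_pos rfl] at h1 h2
      rw [← mul_one (1:ℂ)]
      nth_rw 1 [← h1]
      rw [← h2, Finset.sum_mul_sum]
      refine Finset.sum_congr rfl fun p' _ => Finset.sum_congr rfl fun s' _ => ?_
      ring
    simp only [this]
    simp
  · simp only [M]
    simp_rw [← integral_finsetSum _ fun s _ => integrable_M μ a b _ s s _]
    rw [← integral_finsetSum _ fun p _ => integrable_finsetSum _ fun s _ => integrable_M μ a b p s s p]
    have : ∀ U : Matrix.unitaryGroup I ℂ, ∑ p, ∑ s, (U : Matrix I I ℂ) p a * (U : Matrix I I ℂ) s b *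
    star ((U : Matrix I I ℂ) s a) * star ((U : Matrix I I ℂ) p b) = if a = b then 1 else 0 := by
      intro U
      have h1 := orth U a b
      have h2 := orth U b a
      have h3 : (if a = b then (1:ℂ) else 0) = (if b = a then 1 else 0) * (if a = b then 1 else 0) := by
        split_ifs <;> grind
      rw [h3, ← h1, ← h2, Finset.sum_mul_sum]
      refine Finset.sum_congr rfl fun p' _ => Finset.sum_congr rfl fun s' _ => ?_
      ring
    simp only [this]
    simp

end HaarAux

/-- The Haar-averaged overlap `E f = E Tr[ω_k · (Φ ⊗ Φ̄)(ω_d)]` for conjugate random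
quantum channels built from `d` columns of a Haar-random unitary on `ℂ^n ⊗ ℂ^k`:
`∫ f(U) dμ(U) = ( d n (k²−1) + k (n²−1) ) / ( k (k²n²−1) )`. -/
theorem stmt_14 (n k d : ℕ) (hn : 0 < n) (hk : 0 < k) (hd : 0 < d)
    (hnk : 2 ≤ n * k) (ι : Fin d → Fin n × Fin k) (hι : Function.Injective ι)
    (μ : Measure (Matrix.unitaryGroup (Fin n × Fin k) ℂ))
    [μ.IsHaarMeasure] [IsProbabilityMeasure μ] :
    ∫ U : Matrix.unitaryGroup (Fin n × Fin k) ℂ,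
        (1 / ((d : ℝ) * k)) *
          ∑ a : Fin d, ∑ b : Fin d, ∑ j : Fin k, ∑ j' : Fin k,
            Complex.normSq
              (∑ i : Fin n,
                (U : Matrix (Fin n × Fin k) (Fin n × Fin k) ℂ) (i, j) (ι a) *
                  (starRingEnd ℂ)
                    ((U : Matrix (Fin n × Fin k) (Fin n × Fin k) ℂ) (i, j') (ι b))) ∂μ
      = ((d : ℝ) * n * ((k : ℝ)^2 - 1) + (k : ℝ) * ((n : ℝ)^2 - 1)) /
          ((k : ℝ) * ((k : ℝ)^2 * (n : ℝ)^2 - 1)) := by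
  have hc : 2 ≤ Fintype.card (Fin n × Fin k) := by simpa using hnk
  have key : ∀ U : Matrix.unitaryGroup (Fin n × Fin k) ℂ, (((1 / ((d : ℝ) * k)) *
          ∑ a : Fin d, ∑ b : Fin d, ∑ j : Fin k, ∑ j' : Fin k,
            Complex.normSq
              (∑ i : Fin n,
                (U : Matrix (Fin n × Fin k) (Fin n × Fin k) ℂ) (i, j) (ι a) *
                  (starRingEnd ℂ)
                    ((U : Matrix (Fin n × Fin k) (Fin n × Fin k) ℂ) (i, j') (ι b))) : ℝ) : ℂ)
      = (1 / ((d : ℂ) * k)) * ∑ a : Fin d, ∑ b : Fin d, ∑ j : Fin k, ∑ j' : Fin k, ∑ i : Fin n, ∑ i' : Fin n,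
        ((U : Matrix (Fin n × Fin k) (Fin n × Fin k) ℂ) (i, j) (ι a) *
          (U : Matrix (Fin n × Fin k) (Fin n × Fin k) ℂ) (i', j') (ι b) *
          star ((U : Matrix (Fin n × Fin k) (Fin n × Fin k) ℂ) (i', j) (ι a)) *
          star ((U : Matrix (Fin n × Fin k) (Fin n × Fin k) ℂ) (i, j') (ι b))) := by
    intro U
    push_cast
    congr 1
    refine Finset.sum_congr rfl fun a _ => Finset.sum_congr rfl fun b _ =>
      Finset.sum_congr rfl fun j _ => Finset.sum_congr rfl fun j' _ => ?_
    rw [← Complex.mul_conj, map_sum, Finset.sum_mul_sum]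
    refine Finset.sum_congr rfl fun i _ => Finset.sum_congr rfl fun i' _ => ?_
    simp only [map_mul, Complex.conj_conj, ← starRingEnd_apply]
    ring
  apply Complex.ofReal_injective
  rw [← integral_complex_ofReal]
  simp only [key]
  rw [integral_const_mul]
  have hi := fun a b i i' j j' => HaarAux.integrable_M μ (ι a) (ι b) (i, j) (i', j') (i', j) (i, j')
  have i1 := fun a b j j' i => integrable_finsetSum Finset.univ fun i' _ => hi a b i i' j j'
  have i2 := fun a b j j' => integrable_finsetSum Finset.univ fun i _ => i1 a b j j' i
  have i3 := fun a b j => integrable_finsetSum Finset.univ fun j' _ => i2 a b j j'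
  have i4 := fun a b => integrable_finsetSum Finset.univ fun j _ => i3 a b j
  have i5 := fun a => integrable_finsetSum Finset.univ fun b _ => i4 a b
  have main : ∀ a b, ∑ j : Fin k, ∑ j' : Fin k, ∑ i : Fin n, ∑ i' : Fin n,
      HaarAux.M μ (ι a) (ι b) (i, j) (i', j') (i', j) (i, j') =
      (k:ℂ)^2 * n * (((n * k : ℂ) - (if a = b then 1 else 0)) /
        ((n * k) * ((n * k : ℂ)^2 - 1))) + (k:ℂ) * n^2 * (((n * k) * (if a = b then 1 else 0) - 1) /
        ((n * k) * ((n * k : ℂ)^2 - 1))) := by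
    intro a b
    simp only [HaarAux.M_eq μ hc, Prod.mk.injEq, and_true, true_and, hι.eq_iff, Fintype.card_prod,
      Fintype.card_fin, Nat.cast_mul]
    generalize ((n * k : ℂ) - (if a = b then 1 else 0)) / ((n * k) * ((n * k : ℂ)^2 - 1)) = A
    generalize ((n * k) * (if a = b then 1 else 0) - 1) / ((n * k) * ((n * k : ℂ)^2 - 1)) = B
    have e1 : ∀ i i' : Fin n, (i = i' ∧ i' = i) ↔ i = i' := by grind
    have e2 : ∀ i i' : Fin k, (i = i' ∧ i' = i) ↔ i = i' := by grind
    simp only [e1, e2, Finset.sum_add_distrib, Finset.sum_ite_eq, Finset.mem_univ, if_true, Finset.sum_const, Finset.card_univ, Fintype.card_fin, smul_ite, smul_zero, nsmul_eq_mul]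
    ring
  have step : ∫ U : Matrix.unitaryGroup (Fin n × Fin k) ℂ, (∑ a : Fin d, ∑ b : Fin d, ∑ j : Fin k, ∑ j' : Fin k, ∑ i : Fin n, ∑ i' : Fin n,
        ((U : Matrix (Fin n × Fin k) (Fin n × Fin k) ℂ) (i, j) (ι a) *
          (U : Matrix (Fin n × Fin k) (Fin n × Fin k) ℂ) (i', j') (ι b) *
          star ((U : Matrix (Fin n × Fin k) (Fin n × Fin k) ℂ) (i', j) (ι a)) *
          star ((U : Matrix (Fin n × Fin k) (Fin n × Fin k) ℂ) (i, j') (ι b)))) ∂μ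
      = ∑ a : Fin d, ∑ b : Fin d, ∑ j : Fin k, ∑ j' : Fin k, ∑ i : Fin n, ∑ i' : Fin n,
      HaarAux.M μ (ι a) (ι b) (i, j) (i', j') (i', j) (i, j') := by
    rw [integral_finsetSum _ fun a _ => i5 a]
    refine Finset.sum_congr rfl fun a _ => ?_
    rw [integral_finsetSum _ fun b _ => i4 a b]
    refine Finset.sum_congr rfl fun b _ => ?_
    rw [integral_finsetSum _ fun j _ => i3 a b j]
    refine Finset.sum_congr rfl fun j _ => ?_
    rw [integral_finsetSum _ fun j' _ => i2 a b j j']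
    refine Finset.sum_congr rfl fun j' _ => ?_
    rw [integral_finsetSum _ fun i _ => i1 a b j j' i]
    refine Finset.sum_congr rfl fun i _ => ?_
    rw [integral_finsetSum _ fun i' _ => hi a b i i' j j']
    rfl
  rw [step]
  simp only [main]
  have n0 : (n : ℂ) ≠ 0 := by exact_mod_cast hn.ne'
  have k0 : (k : ℂ) ≠ 0 := by exact_mod_cast hk.ne'
  have d0 : (d : ℂ) ≠ 0 := by exact_mod_cast hd.ne'
  have n1 : (n * k : ℂ)^2 - 1 ≠ 0 := by
    have : (n * k)^2 ≠ 1 := by nlinarith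
    intro hh
    apply this
    have : (n * k : ℂ)^2 = 1 := by linear_combination hh
    exact_mod_cast this
  have lin : ∀ a b : Fin d, (k:ℂ)^2 * n * (((n * k : ℂ) - (if a = b then 1 else 0)) /
        ((n * k) * ((n * k : ℂ)^2 - 1))) + (k:ℂ) * n^2 * (((n * k) * (if a = b then 1 else 0) - 1) /
        ((n * k) * ((n * k : ℂ)^2 - 1))) =
      (n * (k^2-1)) / ((n * k : ℂ)^2 - 1) + (if a = b then (k * (n^2-1)) / ((n * k : ℂ)^2 - 1) else 0) := by
    intro a b
    split_ifs <;> field_simp <;> ring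
  simp only [lin, Finset.sum_add_distrib, Finset.sum_ite_eq, Finset.mem_univ, if_true, Finset.sum_const, Finset.card_univ, Fintype.card_fin, nsmul_eq_mul]
  push_cast
  have n2 : (k:ℂ)^2 * n^2 - 1 ≠ 0 := by
    intro hh; apply n1; linear_combination hh
  have n3 : (n * k : ℂ)^2 - 1 = (k:ℂ)^2 * n^2 - 1 := by ring
  rw [n3]
  field_simp
end

section
/- Let d be a positive integer, fix an index o in {1,…,d}³, and for unitaries U₁, U₂, U₃ ∈ U(d³), each viewed as a matrix indexed by triples in {1,…,d}³, define the random tensor Ψ(a₁,a₂,a₃) = d^{−3/2} Σ_{x,y,z=1}^{d} U₁((a₁,x,z),o) · U₂((a₂,x,y),o) · U₃((a₃,y,z),o). Then the average of the squared norm-square over three independent Haar unitaries satisfies ∫∫∫ ( Σ_{a₁,a₂,a₃} |Ψ(a₁,a₂,a₃)|² )² dμ(U₁) dμ(U₂) dμ(U₃) = (d² − 2d + 3) / ( d⁷ (d+1) (d² − d + 1)³ ). -/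
open MeasureTheory Matrix

set_option linter.all false
set_option linter.unusedSectionVars false
set_option linter.unusedVariables false
set_option linter.unusedSimpArgs false
section moments
variable {ι : Type*} [Fintype ι] [DecidableEq ι]

/-- Generalized reflection. -/
theorem refl_unitary (w : ι → ℂ) (t : ℂ) (h : t + star t = t * star t * ∑ j, star (w j) * w j) :
    (1 - t • vecMulVec w (star w)) ∈ Matrix.unitaryGroup ι ℂ := by
  rw [Matrix.mem_unitaryGroup_iff]
  ext i k
  have e : ∀ i j, (1 - t • vecMulVec w (star w)) i j = (1 : Matrix ι ι ℂ) i j - t * (w i * star (w j)) := by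
    intro i j; simp [vecMulVec_apply]
  have e2 : ∀ i j, (star (1 - t • vecMulVec w (star w))) i j
      = (1 : Matrix ι ι ℂ) i j - star t * (w i * star (w j)) := by
    intro i j
    rw [Matrix.star_apply, e]
    have h1 : star ((1 : Matrix ι ι ℂ) j i) = (1 : Matrix ι ι ℂ) i j := by
      rw [← Matrix.star_apply, star_one]
    rw [star_sub, h1, star_mul', star_mul', star_star]
    ring
  rw [Matrix.mul_apply]
  simp only [e, e2]
  have : ∀ j, ((1 : Matrix ι ι ℂ) i j - t * (w i * star (w j))) *
      ((1 : Matrix ι ι ℂ) j k - star t * (w j * star (w k))) =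
      (1 : Matrix ι ι ℂ) i j * (1 : Matrix ι ι ℂ) j k
       - (1 : Matrix ι ι ℂ) i j * (star t * (w j * star (w k)))
       - (t * (w i * star (w j))) * (1 : Matrix ι ι ℂ) j k
       + (t * star t * w i * star (w k)) * (star (w j) * w j) := by intro j; ring
  simp only [this, Finset.sum_add_distrib, Finset.sum_sub_distrib, ← Finset.mul_sum]
  simp only [Matrix.one_apply, ite_mul, mul_ite, one_mul, zero_mul, mul_one, mul_zero,
    Finset.sum_ite_eq, Finset.sum_ite_eq', Finset.mem_univ, if_true]
  linear_combination (- w i * star (w k)) * h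

theorem refl_apply (w : ι → ℂ) (t : ℂ) (U : Matrix ι ι ℂ) (i o : ι) :
    ((1 - t • vecMulVec w (star w)) * U) i o = U i o - t * w i * ∑ j, star (w j) * U j o := by
  rw [Matrix.sub_mul, Matrix.one_mul, Matrix.sub_apply, Matrix.smul_mul, Matrix.smul_apply,
    Matrix.mul_apply]
  simp [vecMulVec_apply, Finset.mul_sum, mul_assoc]

variable (μ : Measure (Matrix.unitaryGroup ι ℂ)) [μ.IsHaarMeasure] [IsProbabilityMeasure μ]

/-- Quartic monomial. -/
noncomputable def mono4 (o i j k l : ι) (U : Matrix.unitaryGroup ι ℂ) : ℂ :=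
  U.1 i o * U.1 j o * star (U.1 k o) * star (U.1 l o)

theorem mono4_integrable (o i j k l : ι) : Integrable (mono4 o i j k l) μ := by
  have hc : ∀ i, Continuous fun U : Matrix.unitaryGroup ι ℂ => U.1 i o := fun i =>
    (continuous_subtype_val.matrix_elem i o)
  refine Integrable.of_bound (C := 1) ?_ (Filter.Eventually.of_forall fun U => ?_)
  · apply Continuous.aestronglyMeasurable
    unfold mono4
    exact (((hc i).mul (hc j)).mul (hc k).star).mul (hc l).star
  · have hb := fun i => entry_norm_bound_of_unitary U.2 i o
    simp only [mono4, norm_mul, norm_star]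
    calc _ ≤ (1:ℝ) * 1 * 1 * 1 := by gcongr <;> apply hb
      _ = 1 := by norm_num

/-- Moments. -/
noncomputable def mom (o i j k l : ι) : ℂ := ∫ U, mono4 o i j k l U ∂μ

theorem inv_refl (w : ι → ℂ) (t : ℂ) (h : t + star t = t * star t * ∑ j, star (w j) * w j)
    (o i j k l : ι) :
    mom μ o i j k l = ∫ U : Matrix.unitaryGroup ι ℂ,
      (U.1 i o - t * w i * ∑ j, star (w j) * U.1 j o) *
      (U.1 j o - t * w j * ∑ j, star (w j) * U.1 j o) *
      star (U.1 k o - t * w k * ∑ j, star (w j) * U.1 j o) *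
      star (U.1 l o - t * w l * ∑ j, star (w j) * U.1 j o) ∂μ := by
  rw [mom, ← integral_mul_left_eq_self _ (⟨_, refl_unitary w t h⟩ : Matrix.unitaryGroup ι ℂ)]
  congr 1
  ext U
  simp only [mono4, Submonoid.coe_mul, refl_apply]

theorem mom_phase (p o i j k l : ι)
    (h : (if i = p then Complex.I else 1) * (if j = p then Complex.I else 1) *
      (if k = p then -Complex.I else 1) * (if l = p then -Complex.I else 1) ≠ 1) :
    mom μ o i j k l = 0 := by
  have key := inv_refl μ (Pi.single p 1) (1 - Complex.I) (by
    simp [Pi.single_apply]; ring_nf; simp; norm_num) o i j k l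
  have e : ∀ (U : Matrix.unitaryGroup ι ℂ) i, U.1 i o - (1 - Complex.I) * (Pi.single p 1 : ι → ℂ) i *
      ∑ j, star ((Pi.single p 1 : ι → ℂ) j) * U.1 j o = (if i = p then Complex.I else 1) * U.1 i o := by
    intro U i
    simp only [Pi.single_apply]
    split_ifs with hi
    · subst hi; simp; ring
    · simp
  simp only [e] at key
  have : mom μ o i j k l = ((if i = p then Complex.I else 1) * (if j = p then Complex.I else 1) *
      (if k = p then -Complex.I else 1) * (if l = p then -Complex.I else 1)) * mom μ o i j k l := by
    nth_rw 1 [key]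
    rw [mom, ← integral_const_mul]
    congr 1
    ext U
    have hs : ∀ k, star (if k = p then Complex.I else 1) = (if k = p then -Complex.I else 1) := by
      intro k; split_ifs <;> simp
    simp only [star_mul', hs, mono4]
    ring
  by_contra h0
  apply h
  exact mul_right_cancel₀ h0 (by rw [← this, one_mul])

theorem mom_zero (o i j k l : ι) (h : ¬ (i = k ∧ j = l)) (h' : ¬ (i = l ∧ j = k)) :
    mom μ o i j k l = 0 := by
  have hI : Complex.I ≠ 1 := by intro h; simpa using congrArg Complex.re h
  have hI' : -Complex.I ≠ 1 := by intro h; simpa using congrArg Complex.re h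
  have h1 : (-1 : ℂ) ≠ 1 := by norm_num
  by_cases hik : i = k
  · have hjl : j ≠ l := fun e => h ⟨hik, e⟩
    subst hik
    apply mom_phase μ j
    by_cases hij : i = j
    · subst hij; simp [hjl.symm, hI]
    · simp [hjl.symm, hij, hI]
  · by_cases hil : i = l
    · have hjl : j ≠ k := fun e => h' ⟨hil, e⟩
      subst hil
      apply mom_phase μ j
      by_cases hij : i = j
      · subst hij; simp [hjl.symm, hI]
      · simp [hjl.symm, hij, hI]
    · apply mom_phase μ i
      by_cases hij : i = j
      · subst hij; simp [Ne.symm hik, Ne.symm hil, h1]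
      · simp [Ne.symm hik, Ne.symm hil, Ne.symm hij, hI]

theorem mom_swap34 (o i j k l : ι) : mom μ o i j k l = mom μ o i j l k := by
  unfold mom mono4; congr 1; ext U; ring
theorem mom_swap12 (o i j k l : ι) : mom μ o i j k l = mom μ o j i k l := by
  unfold mom mono4; congr 1; ext U; ring

theorem col_norm (o : ι) (U : Matrix.unitaryGroup ι ℂ) : ∑ i, U.1 i o * star (U.1 i o) = 1 := by
  have := congrFun (congrFun (Matrix.mem_unitaryGroup_iff'.1 U.2) o) o
  rw [Matrix.mul_apply] at this
  simpa [Matrix.star_apply, mul_comm] using this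

theorem mom_sum (o : ι) : ∑ i, ∑ j, mom μ o i j i j = 1 := by
  unfold mom
  have : ∀ i, ∑ j, ∫ U, mono4 o i j i j U ∂μ = ∫ U, ∑ j, mono4 o i j i j U ∂μ := fun i => by
    rw [integral_finsetSum]; intro j _; apply mono4_integrable
  simp only [this]
  rw [← integral_finsetSum _ (fun i _ => integrable_finsetSum _ fun j _ => mono4_integrable μ _ _ _ _ _)]
  have : ∀ U : Matrix.unitaryGroup ι ℂ, ∑ i, ∑ j, mono4 o i j i j U = 1 := by
    intro U
    have h := col_norm o U
    calc _ = (∑ i, U.1 i o * star (U.1 i o)) * (∑ i, U.1 i o * star (U.1 i o)) := by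
          rw [Finset.sum_mul_sum]
          refine Finset.sum_congr rfl fun i _ => Finset.sum_congr rfl fun j _ => ?_
          unfold mono4; ring
      _ = 1 := by rw [h]; ring
  simp [this]

theorem refl2 (p q o : ι) (hpq : p ≠ q) (c : ℂ) (U : Matrix.unitaryGroup ι ℂ) :
   ∑ j, star ((Pi.single p 1 - Pi.single q c : ι → ℂ) j) * U.1 j o = U.1 p o - star c * U.1 q o := by
  simp [Pi.single_apply, sub_mul, Finset.sum_sub_distrib, apply_ite (starRingEnd ℂ)]

theorem refl2n (p q : ι) (hpq : p ≠ q) (c : ℂ) :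
   ∑ j, star ((Pi.single p 1 - Pi.single q c : ι → ℂ) j) * (Pi.single p 1 - Pi.single q c : ι → ℂ) j
     = 1 + star c * c := by
  have : ∀ j, star ((Pi.single p 1 - Pi.single q c : ι → ℂ) j) * (Pi.single p 1 - Pi.single q c : ι → ℂ) j
    = (if j = p then 1 else 0) + if j = q then star c * c else 0 := by
    intro j
    by_cases h1 : j = p
    · subst h1; simp [Pi.single_apply, hpq]
    · by_cases h2 : j = q
      · subst h2; simp [Pi.single_apply, h1]
      · simp [h1, h2]
  simp only [this, Finset.sum_add_distrib]
  simp

theorem mom_swap (p q o i j : ι) (hpq : p ≠ q) :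
    mom μ o i j i j = mom μ o (Equiv.swap p q i) (Equiv.swap p q j) (Equiv.swap p q i) (Equiv.swap p q j) := by
  have key := inv_refl μ (Pi.single p 1 - Pi.single q 1) 1 (by
    rw [refl2n _ _ hpq]; simp) o i j i j
  rw [key, mom]
  congr 1
  ext U
  have e : ∀ i, U.1 i o - 1 * (Pi.single p 1 - Pi.single q 1 : ι → ℂ) i * 
      ∑ j, star ((Pi.single p 1 - Pi.single q 1 : ι → ℂ) j) * U.1 j o = U.1 (Equiv.swap p q i) o := by
    intro i
    rw [refl2 _ _ _ hpq]
    by_cases h1 : i = p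
    · subst h1; simp [Pi.single_apply, hpq]
    · by_cases h2 : i = q
      · subst h2; simp [Pi.single_apply, h1]
      · simp [h1, h2, Equiv.swap_apply_of_ne_of_ne]
  simp only [e, mono4]

theorem mom_diag (p q o : ι) : mom μ o p p p p = mom μ o q q q q := by
  by_cases h : p = q
  · rw [h]
  · simpa using mom_swap μ p q o p p h

theorem mom_rot (p q o : ι) (hpq : p ≠ q) : mom μ o p p p p = 2 * mom μ o p q p q := by
  have key := inv_refl μ (Pi.single p 1 - Pi.single q 2) (2/5) (by
    rw [refl2n _ _ hpq]; simp; norm_num) o p p p p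
  have e : ∀ U : Matrix.unitaryGroup ι ℂ, U.1 p o - (2/5) * (Pi.single p 1 - Pi.single q 2 : ι → ℂ) p * 
      ∑ j, star ((Pi.single p 1 - Pi.single q 2 : ι → ℂ) j) * U.1 j o = 3/5 * U.1 p o + 4/5 * U.1 q o := by
    intro U
    rw [refl2 _ _ _ hpq]
    simp [Pi.single_apply, hpq]; ring
  simp only [e] at key
  have ex : ∀ U : Matrix.unitaryGroup ι ℂ,
     (3/5 * U.1 p o + 4/5 * U.1 q o) * (3/5 * U.1 p o + 4/5 * U.1 q o) *
      star (3/5 * U.1 p o + 4/5 * U.1 q o) * star (3/5 * U.1 p o + 4/5 * U.1 q o)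
     = ∑ i : Fin 2, ∑ j : Fin 2, ∑ k : Fin 2, ∑ l : Fin 2,
       (![3/5,4/5] i * ![3/5,4/5] j * ![3/5,4/5] k * ![3/5,4/5] l : ℂ) *
         mono4 o (![p,q] i) (![p,q] j) (![p,q] k) (![p,q] l) U := by
    intro U
    simp [mono4]
    ring
  simp only [ex] at key
  have hi := fun i j k l => mono4_integrable μ o (![p,q] i) (![p,q] j) (![p,q] k) (![p,q] l)
  have hi' := fun i j k l => (hi i j k l).const_mul (![3/5,4/5] i * ![3/5,4/5] j * ![3/5,4/5] k * ![3/5,4/5] l : ℂ)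
  rw [integral_finsetSum _ (fun i _ => integrable_finsetSum _ fun j _ => integrable_finsetSum _ fun k _ => integrable_finsetSum _ fun l _ => hi' i j k l)] at key
  simp_rw [integral_finsetSum _ (fun j _ => integrable_finsetSum _ fun k _ => integrable_finsetSum _ fun l _ => hi' _ j k l),
    integral_finsetSum _ (fun k _ => integrable_finsetSum _ fun l _ => hi' _ _ k l),
    integral_finsetSum _ (fun l _ => hi' _ _ _ l), integral_const_mul] at key
  change _ = ∑ i : Fin 2, ∑ j : Fin 2, ∑ k : Fin 2, ∑ l : Fin 2,
       (![3/5,4/5] i * ![3/5,4/5] j * ![3/5,4/5] k * ![3/5,4/5] l : ℂ) * 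
         mom μ o (![p,q] i) (![p,q] j) (![p,q] k) (![p,q] l) at key
  simp [Fin.sum_univ_two, mom_zero μ o p p p q, mom_zero μ o p p q p, mom_zero μ o p q p p,
    mom_zero μ o q p p p, mom_zero μ o p p q q, mom_zero μ o q q p p, mom_zero μ o p q q q,
    mom_zero μ o q p q q, mom_zero μ o q q p q, mom_zero μ o q q q p, hpq, hpq.symm] at key
  rw [mom_diag μ q p, mom_swap34 μ o p q q p, mom_swap12 μ o q p p q, mom_swap12 μ o q p q p, mom_swap34 μ o p q q p] at key
  linear_combination (625/288) * key

theorem mom_off (p q r s o : ι) (h : p ≠ q) (h' : r ≠ s) : mom μ o p q p q = mom μ o r s r s := by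
  have h1 := mom_rot μ p q o h
  have h2 := mom_rot μ r s o h'
  have h3 := mom_diag μ p r o
  linear_combination (1/2) * (h3 - h1 + h2)

theorem mom_eq (o i j k l : ι) : mom μ o i j k l =
    ((if i = k ∧ j = l then 1 else 0) + (if i = l ∧ j = k then 1 else 0)) /
      ((Fintype.card ι : ℂ) * (Fintype.card ι + 1)) := by
  set a := mom μ o o o o o with ha
  have hgen : ∀ i j, mom μ o i j i j = a / 2 + if i = j then a / 2 else 0 := by
    intro i j
    by_cases h : i = j
    · subst h; simp [ha, mom_diag μ i o o]
    · have := mom_rot μ i j o h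
      rw [mom_diag μ i o o] at this
      simp only [h, if_false]
      linear_combination (-1/2) * this
  have hs := mom_sum μ o
  simp only [hgen, Finset.sum_add_distrib] at hs
  simp at hs
  have hN : (Fintype.card ι : ℂ) ≠ 0 := by
    have : 0 < Fintype.card ι := Fintype.card_pos_iff.2 ⟨o⟩
    exact_mod_cast this.ne'
  have hN1 : (Fintype.card ι : ℂ) + 1 ≠ 0 := by exact_mod_cast Nat.succ_ne_zero (Fintype.card ι)
  have hav : a / 2 = 1 / ((Fintype.card ι : ℂ) * (Fintype.card ι + 1)) := by
    rw [eq_div_iff (mul_ne_zero hN hN1)]; linear_combination hs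
  by_cases h1 : i = k ∧ j = l
  · obtain ⟨rfl, rfl⟩ := h1
    rw [hgen, hav]
    by_cases hij : i = j
    · subst hij; simp only [and_self, if_true]; rw [add_div]
    · simp [hij]
  · by_cases h2 : i = l ∧ j = k
    · obtain ⟨rfl, rfl⟩ := h2
      rw [mom_swap34, hgen, hav]
      have : i ≠ j := fun e => h1 ⟨e, e.symm⟩
      simp [this]
    · rw [mom_zero μ o i j k l h1 h2]; simp [h1, h2]
end moments

section main
variable {d : ℕ}

abbrev TT (d : ℕ) := Fin d × Fin d × Fin d
abbrev QQ (d : ℕ) := Fin d × Fin d × Fin d × Fin d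

/-- The index equivalence. -/
def idxEquiv (d : ℕ) : (TT d × TT d × TT d × TT d × TT d × TT d) ≃
    (QQ d × QQ d × QQ d) × ((Fin d × Fin d) × (Fin d × Fin d) × (Fin d × Fin d)) where
  toFun := fun ⟨a, b, p, q, r, s⟩ =>
    ⟨⟨⟨p.1, q.1, r.1, s.1⟩, ⟨p.2.1, q.2.1, r.2.1, s.2.1⟩, ⟨p.2.2, q.2.2, r.2.2, s.2.2⟩⟩,
      ⟨⟨a.1, b.1⟩, ⟨a.2.1, b.2.1⟩, ⟨a.2.2, b.2.2⟩⟩⟩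
  invFun := fun ⟨⟨x, y, z⟩, ⟨a, b, c⟩⟩ =>
    ⟨⟨a.1, b.1, c.1⟩, ⟨a.2, b.2, c.2⟩, ⟨x.1, y.1, z.1⟩, ⟨x.2.1, y.2.1, z.2.1⟩,
      ⟨x.2.2.1, y.2.2.1, z.2.2.1⟩, ⟨x.2.2.2, y.2.2.2, z.2.2.2⟩⟩
  left_inv := fun _ => rfl
  right_inv := fun _ => rfl

noncomputable def mm (o : TT d) (a : Fin d × Fin d) (x y : QQ d) (U : Matrix.unitaryGroup (TT d) ℂ) : ℂ :=
  mono4 o (a.1, x.1, y.1) (a.2, x.2.1, y.2.1) (a.1, x.2.2.1, y.2.2.1) (a.2, x.2.2.2, y.2.2.2) U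

theorem expand1 (F : TT d → TT d → ℂ) :
    (∑ a, (∑ p, F a p) * star (∑ p, F a p)) ^ 2 =
      ∑ s : TT d × TT d × TT d × TT d × TT d × TT d,
        F s.1 s.2.2.1 * star (F s.1 s.2.2.2.2.1) *
          (F s.2.1 s.2.2.2.1 * star (F s.2.1 s.2.2.2.2.2)) := by
  rw [sq, Finset.sum_mul_sum]
  simp only [Fintype.sum_prod_type (α₁ := TT d)]
  refine Finset.sum_congr rfl fun a _ => Finset.sum_congr rfl fun b _ => ?_
  simp only [star_sum, ← Finset.mul_sum, ← Finset.sum_mul]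

theorem expand (o : TT d) (U V W : Matrix.unitaryGroup (TT d) ℂ) :
    (∑ a : TT d, (∑ p : TT d, U.1 (a.1, p.1, p.2.2) o * V.1 (a.2.1, p.1, p.2.1) o *
        W.1 (a.2.2, p.2.1, p.2.2) o) * star (∑ p : TT d, U.1 (a.1, p.1, p.2.2) o * V.1 (a.2.1, p.1, p.2.1) o *
        W.1 (a.2.2, p.2.1, p.2.2) o)) ^ 2 =
    ∑ s : (QQ d × QQ d × QQ d) × ((Fin d × Fin d) × (Fin d × Fin d) × (Fin d × Fin d)),
      mm o s.2.1 s.1.1 s.1.2.2 U * (mm o s.2.2.1 s.1.1 s.1.2.1 V * mm o s.2.2.2 s.1.2.1 s.1.2.2 W) := by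
  rw [expand1 (fun a p : TT d => U.1 (a.1, p.1, p.2.2) o * V.1 (a.2.1, p.1, p.2.1) o *
        W.1 (a.2.2, p.2.1, p.2.2) o)]
  refine Fintype.sum_equiv (idxEquiv d) _ _ ?_
  rintro ⟨a, b, p, q, r, s⟩
  simp only [idxEquiv, Equiv.coe_fn_mk, mm, mono4, star_mul']
  ring

noncomputable def PP (x : QQ d) : ℂ := if x.1 = x.2.2.1 ∧ x.2.1 = x.2.2.2 then 1 else 0
noncomputable def SS (x : QQ d) : ℂ := if x.1 = x.2.2.2 ∧ x.2.1 = x.2.2.1 then 1 else 0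

theorem sumP : ∑ x : QQ d, PP x = (d : ℂ) ^ 2 := by
  simp [PP, Fintype.sum_prod_type, ite_and, sq]
theorem sumS : ∑ x : QQ d, SS x = (d : ℂ) ^ 2 := by
  simp [SS, Fintype.sum_prod_type, ite_and, sq]
theorem sumPS : ∑ x : QQ d, PP x * SS x = (d : ℂ) := by
  simp [PP, SS, Fintype.sum_prod_type, ite_and]
theorem PP_sq (x : QQ d) : PP x * PP x = PP x := by simp [PP]
theorem SS_sq (x : QQ d) : SS x * SS x = SS x := by simp [SS]

theorem mm_int (μ : Measure (Matrix.unitaryGroup (TT d) ℂ)) [μ.IsHaarMeasure]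
    [IsProbabilityMeasure μ] (o : TT d) (a : Fin d × Fin d) (x y : QQ d) :
    ∫ U, mm o a x y U ∂μ = (PP x * PP y + (if a.1 = a.2 then 1 else 0) * (SS x * SS y)) /
      ((d : ℂ) ^ 3 * ((d : ℂ) ^ 3 + 1)) := by
  have := mom_eq μ o (a.1, x.1, y.1) (a.2, x.2.1, y.2.1) (a.1, x.2.2.1, y.2.2.1) (a.2, x.2.2.2, y.2.2.2)
  unfold mom at this
  unfold mm
  rw [this]
  have hc : ((Fintype.card (TT d) : ℕ) : ℂ) = (d : ℂ) ^ 3 := by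
    simp; ring
  rw [hc]
  congr 1
  simp only [PP, SS, Prod.mk.injEq, true_and, eq_comm (a := a.2) (b := a.1)]
  congr 1
  · split_ifs <;> first | (exfalso; tauto) | simp
  · split_ifs <;> first | (exfalso; tauto) | simp

theorem sumA (x y : QQ d) (c : ℂ) : ∑ a : Fin d × Fin d,
    (PP x * PP y + (if a.1 = a.2 then 1 else 0) * (SS x * SS y)) / c =
     ((d : ℂ) ^ 2 * (PP x * PP y) + d * (SS x * SS y)) / c := by
  rw [← Finset.sum_div, Finset.sum_add_distrib, ← Finset.sum_mul]
  simp [Fintype.sum_prod_type, sq, mul_assoc]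

theorem sumprod {α β γ : Type*} [Fintype α] [Fintype β] [Fintype γ] (f : α → ℂ) (g : β → ℂ)
    (h : γ → ℂ) : ∑ s : α × β × γ, f s.1 * (g s.2.1 * h s.2.2) =
      (∑ x, f x) * ((∑ y, g y) * (∑ z, h z)) := by
  simp only [Fintype.sum_prod_type]
  rw [Finset.sum_mul_sum Finset.univ Finset.univ g h, Finset.sum_mul]
  simp only [Finset.mul_sum]

theorem sum3 (f g h : QQ d → ℂ) : ∑ x, ∑ y, ∑ z, f x * g y * h z =
    (∑ x, f x) * (∑ y, g y) * (∑ z, h z) := by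
  rw [mul_assoc, ← sumprod]
  simp only [Fintype.sum_prod_type (α₁ := QQ d), mul_assoc]

theorem total (D : ℂ) : ∑ x : QQ d, ∑ y : QQ d, ∑ z : QQ d,
    (D ^ 2 * (PP x * PP z) + D * (SS x * SS z)) * ((D ^ 2 * (PP x * PP y) + D * (SS x * SS y)) *
      (D ^ 2 * (PP y * PP z) + D * (SS y * SS z))) =
    D ^ 6 * d ^ 6 + 3 * D ^ 5 * d ^ 4 + 3 * D ^ 4 * d ^ 4 + D ^ 3 * d ^ 6 := by
  have : ∀ x y z : QQ d, (D ^ 2 * (PP x * PP z) + D * (SS x * SS z)) * ((D ^ 2 * (PP x * PP y) + D * (SS x * SS y)) *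
      (D ^ 2 * (PP y * PP z) + D * (SS y * SS z))) =
     D ^ 6 * (PP x * PP y * PP z)
     + D ^ 5 * (PP x * (PP y * SS y) * (PP z * SS z))
     + D ^ 5 * ((PP x * SS x) * PP y * (PP z * SS z))
     + D ^ 5 * ((PP x * SS x) * (PP y * SS y) * PP z)
     + D ^ 4 * (SS x * (PP y * SS y) * (PP z * SS z))
     + D ^ 4 * ((PP x * SS x) * SS y * (PP z * SS z))
     + D ^ 4 * ((PP x * SS x) * (PP y * SS y) * SS z)
     + D ^ 3 * (SS x * SS y * SS z) := by
    intro x y z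
    have h1 := PP_sq x
    have h2 := PP_sq y
    have h3 := PP_sq z
    have h4 := SS_sq x
    have h5 := SS_sq y
    have h6 := SS_sq z
    generalize PP x = a at *
    generalize PP y = b at *
    generalize PP z = c at *
    generalize SS x = e at *
    generalize SS y = f at *
    generalize SS z = g at *
    grind
  simp only [this, Finset.sum_add_distrib, ← Finset.mul_sum]
  simp only [sum3, sumP, sumS, sumPS, ← Finset.mul_sum, ← Finset.sum_mul]
  ring

theorem final_int (μ : Measure (Matrix.unitaryGroup (TT d) ℂ)) [μ.IsHaarMeasure]
    [IsProbabilityMeasure μ] (o : TT d) :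
    ∫ U, ∫ V, ∫ W, (∑ s : (QQ d × QQ d × QQ d) × ((Fin d × Fin d) × (Fin d × Fin d) × (Fin d × Fin d)),
      mm o s.2.1 s.1.1 s.1.2.2 U * (mm o s.2.2.1 s.1.1 s.1.2.1 V * mm o s.2.2.2 s.1.2.1 s.1.2.2 W)) ∂μ ∂μ ∂μ
    = ((d:ℂ) ^ 12 + 4 * d ^ 9 + 3 * d ^ 8) / ((d : ℂ) ^ 3 * ((d : ℂ) ^ 3 + 1)) ^ 3 := by
  have hi : ∀ (a : Fin d × Fin d) (x y : QQ d), Integrable (fun U => mm o a x y U) μ :=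
    fun a x y => mono4_integrable μ _ _ _ _ _
  have e1 : ∀ U V, ∫ W, (∑ s : (QQ d × QQ d × QQ d) × ((Fin d × Fin d) × (Fin d × Fin d) × (Fin d × Fin d)),
      mm o s.2.1 s.1.1 s.1.2.2 U * (mm o s.2.2.1 s.1.1 s.1.2.1 V * mm o s.2.2.2 s.1.2.1 s.1.2.2 W)) ∂μ
      = ∑ s : (QQ d × QQ d × QQ d) × ((Fin d × Fin d) × (Fin d × Fin d) × (Fin d × Fin d)),
      mm o s.2.1 s.1.1 s.1.2.2 U * (mm o s.2.2.1 s.1.1 s.1.2.1 V * ∫ W, mm o s.2.2.2 s.1.2.1 s.1.2.2 W ∂μ) := by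
    intro U V
    rw [integral_finsetSum _ fun s _ => ((hi _ _ _).const_mul _).const_mul _]
    simp only [integral_const_mul]
  have e2 : ∀ U, ∫ V, (∑ s : (QQ d × QQ d × QQ d) × ((Fin d × Fin d) × (Fin d × Fin d) × (Fin d × Fin d)),
      mm o s.2.1 s.1.1 s.1.2.2 U * (mm o s.2.2.1 s.1.1 s.1.2.1 V * ∫ W, mm o s.2.2.2 s.1.2.1 s.1.2.2 W ∂μ)) ∂μ
      = ∑ s : (QQ d × QQ d × QQ d) × ((Fin d × Fin d) × (Fin d × Fin d) × (Fin d × Fin d)),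
      mm o s.2.1 s.1.1 s.1.2.2 U * ((∫ V, mm o s.2.2.1 s.1.1 s.1.2.1 V ∂μ) * ∫ W, mm o s.2.2.2 s.1.2.1 s.1.2.2 W ∂μ) := by
    intro U
    rw [integral_finsetSum _ fun s _ => ((hi _ _ _).mul_const _).const_mul _]
    simp only [integral_const_mul, integral_mul_const]
  simp only [e1, e2]
  rw [integral_finsetSum _ fun s _ => (hi _ _ _).mul_const _]
  simp only [integral_mul_const, mm_int]
  generalize hc : (d : ℂ) ^ 3 * ((d : ℂ) ^ 3 + 1) = c
  rw [Fintype.sum_prod_type]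
  have e3 : ∀ t : QQ d × QQ d × QQ d, ∑ s : ((Fin d × Fin d) × (Fin d × Fin d) × (Fin d × Fin d)),
     (PP t.1 * PP t.2.2 + (if s.1.1 = s.1.2 then 1 else 0) * (SS t.1 * SS t.2.2)) / c *
     ((PP t.1 * PP t.2.1 + (if s.2.1.1 = s.2.1.2 then 1 else 0) * (SS t.1 * SS t.2.1)) / c *
     ((PP t.2.1 * PP t.2.2 + (if s.2.2.1 = s.2.2.2 then 1 else 0) * (SS t.2.1 * SS t.2.2)) / c))
     = ((d : ℂ) ^ 2 * (PP t.1 * PP t.2.2) + d * (SS t.1 * SS t.2.2)) *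
      (((d : ℂ) ^ 2 * (PP t.1 * PP t.2.1) + d * (SS t.1 * SS t.2.1)) *
       ((d : ℂ) ^ 2 * (PP t.2.1 * PP t.2.2) + d * (SS t.2.1 * SS t.2.2))) / c ^ 3 := by
    intro t
    rw [sumprod
      (fun s : Fin d × Fin d => (PP t.1 * PP t.2.2 + (if s.1 = s.2 then 1 else 0) * (SS t.1 * SS t.2.2)) / c)
      (fun s : Fin d × Fin d => (PP t.1 * PP t.2.1 + (if s.1 = s.2 then 1 else 0) * (SS t.1 * SS t.2.1)) / c)
      (fun s : Fin d × Fin d => (PP t.2.1 * PP t.2.2 + (if s.1 = s.2 then 1 else 0) * (SS t.2.1 * SS t.2.2)) / c),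
      sumA, sumA, sumA]
    ring
  simp only [e3]
  rw [← Finset.sum_div]
  congr 1
  simp only [Fintype.sum_prod_type (α₁ := QQ d)]
  rw [total]
  ring
end main

/-- The Haar-averaged partition function `Z̄_∅ = E Tr[ρ ⊗ ρ]` of the random tensor
network state of the triangle graph with bond dimension `d`:
`E (Σ |Ψ|²)² = (d² − 2d + 3) / ( d⁷ (d+1) (d² − d + 1)³ )`. -/
theorem stmt_15 (d : ℕ) (hd : 0 < d) (o : Fin d × Fin d × Fin d)
    (μ : Measure (Matrix.unitaryGroup (Fin d × Fin d × Fin d) ℂ))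
    [μ.IsHaarMeasure] [IsProbabilityMeasure μ] :
    (∫ U₁ : Matrix.unitaryGroup (Fin d × Fin d × Fin d) ℂ,
      ∫ U₂ : Matrix.unitaryGroup (Fin d × Fin d × Fin d) ℂ,
      ∫ U₃ : Matrix.unitaryGroup (Fin d × Fin d × Fin d) ℂ,
        (∑ a₁ : Fin d, ∑ a₂ : Fin d, ∑ a₃ : Fin d,
          Complex.normSq
            ((((d : ℝ) ^ (-(3 : ℝ)/2) : ℝ) : ℂ) *
              ∑ x : Fin d, ∑ y : Fin d, ∑ z : Fin d,
                (U₁ : Matrix (Fin d × Fin d × Fin d) (Fin d × Fin d × Fin d) ℂ) (a₁, x, z) o *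
                  (U₂ : Matrix (Fin d × Fin d × Fin d) (Fin d × Fin d × Fin d) ℂ) (a₂, x, y) o *
                  (U₃ : Matrix (Fin d × Fin d × Fin d) (Fin d × Fin d × Fin d) ℂ) (a₃, y, z) o)) ^ 2
        ∂μ ∂μ ∂μ)
      = ((d : ℝ)^2 - 2 * d + 3) /
          ((d : ℝ)^7 * ((d : ℝ) + 1) * ((d : ℝ)^2 - d + 1)^3) := by
  have hd0 : (d : ℂ) ≠ 0 := by exact_mod_cast hd.ne'
  have hr : (((d : ℝ) ^ (-(3 : ℝ)/2) : ℝ)) ^ 4 = ((d : ℝ) ^ 6)⁻¹ := by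
    rw [← Real.rpow_natCast, ← Real.rpow_mul (by positivity)]
    norm_num
  have hrc : ((((d : ℝ) ^ (-(3 : ℝ)/2) : ℝ)) : ℂ) ^ 4 = ((d : ℂ) ^ 6)⁻¹ := by
    rw [← Complex.ofReal_pow, hr]; push_cast; rfl
  generalize ((d : ℝ) ^ (-(3 : ℝ)/2) : ℝ) = c at *
  apply Complex.ofReal_injective
  simp only [← integral_complex_ofReal]
  have key : ∀ U₁ U₂ U₃ : Matrix.unitaryGroup (Fin d × Fin d × Fin d) ℂ,
     (((∑ a₁ : Fin d, ∑ a₂ : Fin d, ∑ a₃ : Fin d,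
          Complex.normSq
            ((c : ℂ) *
              ∑ x : Fin d, ∑ y : Fin d, ∑ z : Fin d,
                (U₁ : Matrix (Fin d × Fin d × Fin d) (Fin d × Fin d × Fin d) ℂ) (a₁, x, z) o *
                  (U₂ : Matrix (Fin d × Fin d × Fin d) (Fin d × Fin d × Fin d) ℂ) (a₂, x, y) o *
                  (U₃ : Matrix (Fin d × Fin d × Fin d) (Fin d × Fin d × Fin d) ℂ) (a₃, y, z) o)) ^ 2 : ℝ) : ℂ)
     = ((d : ℂ) ^ 6)⁻¹ * ∑ s : (QQ d × QQ d × QQ d) × ((Fin d × Fin d) × (Fin d × Fin d) × (Fin d × Fin d)),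
      mm o s.2.1 s.1.1 s.1.2.2 U₁ * (mm o s.2.2.1 s.1.1 s.1.2.1 U₂ * mm o s.2.2.2 s.1.2.1 s.1.2.2 U₃) := by
    intro U V W
    rw [← expand, ← hrc]
    simp only [Fintype.sum_prod_type, Complex.normSq_mul, Complex.ofReal_pow, Complex.ofReal_sum,
      Complex.ofReal_mul, Complex.normSq_ofReal, ← Finset.mul_sum, ← Complex.mul_conj, starRingEnd_apply]
    ring
  simp only [key, integral_const_mul]
  rw [final_int]
  have h1 : (d : ℂ) + 1 ≠ 0 := by exact_mod_cast Nat.succ_ne_zero d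
  have h2 : (d : ℂ) ^ 2 - d + 1 ≠ 0 := by
    have : (d : ℝ) ^ 2 - d + 1 ≠ 0 := by nlinarith [sq_nonneg ((d : ℝ) - 1/2)]
    exact_mod_cast this
  have h3 : (d : ℂ) ^ 3 + 1 = (d + 1) * ((d : ℂ) ^ 2 - d + 1) := by ring
  rw [h3]
  push_cast
  generalize hq : (d : ℂ) ^ 2 - d + 1 = q at *
  field_simp
  ring
end
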